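/- arXiv:2303.07813 — 4 statements merged into one kernel-verified Lean document; each statement's English description precedes it below -/
import Mathlib

section
/- There exists a constant C > 0 such that for all N ≥ 2, all s with 1/2 ≤ s < 1, all n, p ∈ ℕ, and all l = (l_1, …, l_N) ∈ ℕ^N with p + l_1 + ⋯ + l_N = n and l_j = 1 for at least two distinct indices j, one has g(l, s, N) ≤ C · ( N⁴ (1−s)⁴ + N² (1−s)³ ) / (1−s)^{2n−2p}. -/
open MeasureTheory Real Filter

noncomputable section

/-- The joint eigenangle density of `SO(2N+1)` on `[0,π]^N`. -/
def densitySO (N : ℕ) (θ : Fin N → ℝ) : ℝ :=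
  (2 ^ (N ^ 2) / (π ^ N * N.factorial)) *
    (∏ j : Fin N, ∏ k ∈ Finset.Ioi j, (Real.cos (θ k) - Real.cos (θ j)) ^ 2) *
    ∏ m : Fin N, Real.sin (θ m / 2) ^ 2

/-- `h(n, s, N)`: the `n`-th moment of the eigenvalue sum against the eigenangle density. -/
def hFun (n : ℕ) (s : ℝ) (N : ℕ) : ℝ :=
  ∫ θ in Set.univ.pi fun _ : Fin N => Set.Icc (0 : ℝ) π,
    ((s - 1) * ∑ j, (2 * s - 2 * Real.cos (θ j)) / (1 + s ^ 2 - 2 * s * Real.cos (θ j))) ^ n *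
      densitySO N θ

/-- `g(l, s, N)`: the integral of `∏_j ((1-s)² + 4s sin²(θ_j/2))^{-l_j}` against the
eigenangle density. -/
def gFun (N : ℕ) (l : Fin N → ℕ) (s : ℝ) : ℝ :=
  ∫ θ in Set.univ.pi fun _ : Fin N => Set.Icc (0 : ℝ) π,
    (∏ j, ((1 - s) ^ 2 + 4 * s * Real.sin (θ j / 2) ^ 2) ^ (-(l j : ℤ))) * densitySO N θ

/-- The monic degree `i` polynomial `2⁻ⁱ (U_i + U_{i-1})`, a rescaled Chebyshev polynomial of the
fourth kind. -/
def chebyshevW : ℕ → Polynomial ℝ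
  | 0 => 1
  | 1 => Polynomial.X + Polynomial.C (1 / 2)
  | i + 2 => Polynomial.X * chebyshevW (i + 1) - Polynomial.C (1 / 4) * chebyshevW i

lemma chebyshevW_natDegree_and_monic :
    ∀ i : ℕ, (chebyshevW i).natDegree = i ∧ (chebyshevW i).Monic
  | 0 => by simp [chebyshevW]
  | 1 => ⟨Polynomial.natDegree_X_add_C _, Polynomial.monic_X_add_C _⟩
  | i + 2 => by
    obtain ⟨hd₁, hm₁⟩ := chebyshevW_natDegree_and_monic (i + 1)
    obtain ⟨hd₀, -⟩ := chebyshevW_natDegree_and_monic i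
    have hd : (Polynomial.X * chebyshevW (i + 1)).natDegree = i + 2 := by
      rw [Polynomial.natDegree_X_mul hm₁.ne_zero, hd₁]
    have hlt : (Polynomial.C (1 / 4 : ℝ) * chebyshevW i).natDegree <
        (Polynomial.X * chebyshevW (i + 1)).natDegree := by
      have := Polynomial.natDegree_C_mul_le (1 / 4 : ℝ) (chebyshevW i)
      omega
    rw [chebyshevW]
    exact ⟨(Polynomial.natDegree_sub_eq_left_of_natDegree_lt hlt).trans hd,
      (Polynomial.monic_X.mul hm₁).sub_of_left (Polynomial.degree_lt_degree hlt)⟩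

lemma sin_half_mul_chebyshevW_eval_cos (x : ℝ) :
    ∀ i : ℕ, 2 ^ i * (sin (x / 2) * (chebyshevW i).eval (cos x)) = sin ((i + 1 / 2) * x)
  | 0 => by simp [chebyshevW, div_eq_inv_mul]
  | 1 => by
    have h : ((1 : ℕ) + 1 / 2 : ℝ) * x = x + x / 2 := by push_cast; ring
    have hx : x = 2 * (x / 2) := by ring
    have hs : sin x = 2 * sin (x / 2) * cos (x / 2) := by rw [← sin_two_mul, ← hx]
    have hc : cos x = 2 * cos (x / 2) ^ 2 - 1 := by rw [← cos_two_mul, ← hx]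
    rw [h, sin_add, hs, hc]
    simp [chebyshevW]
    ring
  | i + 2 => by
    have h₁ := sin_half_mul_chebyshevW_eval_cos x (i + 1)
    have h₀ := sin_half_mul_chebyshevW_eval_cos x i
    have e₂ : ((i + 2 : ℕ) + 1 / 2 : ℝ) * x = ((i + 1 : ℕ) + 1 / 2 : ℝ) * x + x := by
      push_cast; ring
    have e₀ : ((i : ℕ) + 1 / 2 : ℝ) * x = ((i + 1 : ℕ) + 1 / 2 : ℝ) * x - x := by
      push_cast; ring
    rw [e₀, sin_sub] at h₀
    rw [e₂, sin_add]
    simp only [chebyshevW, Polynomial.eval_sub, Polynomial.eval_mul, Polynomial.eval_X,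
      Polynomial.eval_C]
    rw [pow_succ] at h₁
    rw [pow_succ, pow_succ]
    linear_combination 2 * cos x * h₁ - h₀

lemma abs_sin_add_half_mul_le (x : ℝ) (i : ℕ) :
    |sin ((i + 1 / 2) * x)| ≤ (2 * i + 1) * |sin (x / 2)| := by
  induction i with
  | zero => simp [div_eq_inv_mul]
  | succ i ih =>
    have e : ((i + 1 : ℕ) + 1 / 2 : ℝ) * x = (i + 1 / 2 : ℝ) * x + x := by push_cast; ring
    have hs : |sin x| ≤ 2 * |sin (x / 2)| := by
      have : sin x = 2 * sin (x / 2) * cos (x / 2) := by rw [← sin_two_mul]; congr 1; ring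
      rw [this, abs_mul, abs_mul, abs_two]
      exact mul_le_of_le_one_right (by positivity) (abs_cos_le_one _)
    rw [e, sin_add]
    calc _ ≤ |sin ((i + 1 / 2) * x)| * |cos x| + |cos ((i + 1 / 2) * x)| * |sin x| := by
          rw [← abs_mul, ← abs_mul]; exact abs_add_le _ _
      _ ≤ |sin ((i + 1 / 2) * x)| * 1 + 1 * |sin x| := by
          gcongr <;> exact abs_cos_le_one _
      _ ≤ _ := by push_cast; linarith

/-- The orthonormal system on `[0, π]` underlying the `SO(2N+1)` eigenangle process. -/
def sineFun (i : ℕ) (x : ℝ) : ℝ := √(2 / π) * sin ((i + 1 / 2) * x)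

@[fun_prop]
lemma continuous_sineFun (i : ℕ) : Continuous (sineFun i) := by
  unfold sineFun; fun_prop

lemma sineFun_mul_sineFun (i k : ℕ) (x : ℝ) :
    sineFun i x * sineFun k x = 2 / π * (sin ((i + 1 / 2) * x) * sin ((k + 1 / 2) * x)) := by
  have : √(2 / π) * √(2 / π) = 2 / π := mul_self_sqrt (by positivity)
  rw [sineFun, sineFun, mul_mul_mul_comm, this]

lemma integral_cos_int_mul (m : ℤ) (hm : m ≠ 0) : ∫ x in (0 : ℝ)..π, cos (m * x) = 0 := by
  rw [intervalIntegral.integral_comp_mul_left _ (by exact_mod_cast hm)]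
  simp [sin_int_mul_pi]

lemma integral_sineFun_mul_sineFun (i k : ℕ) :
    ∫ x in Set.Icc 0 π, sineFun i x * sineFun k x = if i = k then 1 else 0 := by
  have key : ∀ x : ℝ, sineFun i x * sineFun k x =
      1 / π * (cos (((i - k : ℤ) : ℝ) * x) - cos (((i + k + 1 : ℤ) : ℝ) * x)) := by
    intro x
    have e₁ : ((i - k : ℤ) : ℝ) * x = (i + 1 / 2) * x - (k + 1 / 2) * x := by push_cast; ring
    have e₂ : ((i + k + 1 : ℤ) : ℝ) * x = (i + 1 / 2) * x + (k + 1 / 2) * x := by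
      push_cast; ring
    rw [sineFun_mul_sineFun, e₁, e₂, cos_sub, cos_add]
    ring
  rw [integral_Icc_eq_integral_Ioc, ← intervalIntegral.integral_of_le pi_pos.le]
  simp_rw [key]
  rw [intervalIntegral.integral_const_mul, intervalIntegral.integral_sub
    (Continuous.intervalIntegrable (by fun_prop) _ _)
    (Continuous.intervalIntegrable (by fun_prop) _ _),
    integral_cos_int_mul (i + k + 1) (by omega)]
  split_ifs with h
  · subst h; simp [pi_ne_zero]
  · rw [integral_cos_int_mul _ (by omega)]; simp

lemma densitySO_eq_det_sq (N : ℕ) (θ : Fin N → ℝ) :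
    densitySO N θ =
      1 / N.factorial * (Matrix.of fun i j : Fin N => sineFun i (θ j)).det ^ 2 := by
  have hvand := Matrix.det_eval_matrixOfPolynomials_eq_det_vandermonde (fun j => cos (θ j))
    (fun i : Fin N => chebyshevW i) (fun i => (chebyshevW_natDegree_and_monic i).1)
    (fun i => (chebyshevW_natDegree_and_monic i).2)
  have hdet : (Matrix.of fun i j : Fin N => sineFun i (θ j)).det =
      (∏ i : Fin N, √(2 / π) * 2 ^ (i : ℕ)) * ((∏ j : Fin N, sin (θ j / 2)) *
        (Matrix.vandermonde fun j => cos (θ j)).det) := by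
    rw [hvand, ← Matrix.det_mul_column, ← Matrix.det_mul_row, ← Matrix.det_transpose]
    congr 1
    ext j i
    simp only [Matrix.transpose_apply, Matrix.of_apply, sineFun,
      ← sin_half_mul_chebyshevW_eval_cos]
    ring
  have hsum : (∑ i : Fin N, (i : ℕ)) * 2 + N = N ^ 2 := by
    rw [Fin.sum_univ_eq_sum_range (fun i => i), Finset.sum_range_id_mul_two]
    cases N with
    | zero => rfl
    | succ n => simp; ring
  have hconst : (∏ i : Fin N, √(2 / π) * 2 ^ (i : ℕ)) ^ 2 = 2 ^ (N ^ 2) / π ^ N := by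
    rw [Finset.prod_mul_distrib, Finset.prod_pow_eq_pow_sum, mul_pow, ← pow_mul, ← hsum,
      Finset.prod_const, Finset.card_univ, Fintype.card_fin, ← pow_mul, mul_comm N 2, pow_mul,
      sq_sqrt (by positivity), div_pow, pow_add]
    ring
  rw [hdet, mul_pow, hconst, mul_pow, Matrix.det_vandermonde, densitySO]
  simp only [Finset.prod_pow]
  field_simp

/-- Andréief-type expansion of a weighted squared determinant. -/
lemma integral_prod_mul_det_sq {ι : Type*} [Fintype ι] [DecidableEq ι] {μ : Measure ℝ}
    [SigmaFinite μ] (w φ : ι → ℝ → ℝ)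
    (hint : ∀ j i k, Integrable (fun x => w j x * (φ i x * φ k x)) μ) :
    Integrable (fun θ : ι → ℝ =>
        (∏ j, w j (θ j)) * (Matrix.of fun i j => φ i (θ j)).det ^ 2) (Measure.pi fun _ => μ) ∧
      ∫ θ : ι → ℝ, (∏ j, w j (θ j)) * (Matrix.of fun i j => φ i (θ j)).det ^ 2
          ∂(Measure.pi fun _ => μ) =
        ∑ σ : Equiv.Perm ι, ∑ τ : Equiv.Perm ι,
          ((σ.sign : ℤ) * (τ.sign : ℤ) : ℝ) * ∏ j, ∫ x, w j x * (φ (σ j) x * φ (τ j) x) ∂μ := by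
  have hexp : (fun θ : ι → ℝ => (∏ j, w j (θ j)) * (Matrix.of fun i j => φ i (θ j)).det ^ 2) =
      fun θ => ∑ σ : Equiv.Perm ι, ∑ τ : Equiv.Perm ι, ((σ.sign : ℤ) * (τ.sign : ℤ) : ℝ) *
        ∏ j, w j (θ j) * (φ (σ j) (θ j) * φ (τ j) (θ j)) := by
    ext θ
    rw [sq, Matrix.det_apply', Finset.sum_mul_sum, Finset.mul_sum]
    refine Finset.sum_congr rfl fun σ _ => ?_
    rw [Finset.mul_sum]
    refine Finset.sum_congr rfl fun τ _ => ?_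
    simp only [Matrix.of_apply, Finset.prod_mul_distrib]
    ring
  have hterm : ∀ σ τ : Equiv.Perm ι, Integrable (fun θ : ι → ℝ =>
      ((σ.sign : ℤ) * (τ.sign : ℤ) : ℝ) * ∏ j, w j (θ j) * (φ (σ j) (θ j) * φ (τ j) (θ j)))
      (Measure.pi fun _ => μ) := fun σ τ =>
    (Integrable.fintype_prod (f := fun j x => w j x * (φ (σ j) x * φ (τ j) x))
      fun j => hint j _ _).const_mul _
  rw [hexp]
  refine ⟨integrable_finsetSum _ fun σ _ => integrable_finsetSum _ fun τ _ => hterm σ τ, ?_⟩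
  rw [integral_finsetSum _ fun σ _ => integrable_finsetSum _ fun τ _ => hterm σ τ]
  refine Finset.sum_congr rfl fun σ _ => ?_
  rw [integral_finsetSum _ fun τ _ => hterm σ τ]
  refine Finset.sum_congr rfl fun τ _ => ?_
  rw [integral_const_mul,
    integral_fintype_prod_eq_prod fun j x => w j x * (φ (σ j) x * φ (τ j) x)]

lemma Equiv.Perm.eq_or_eq_mul_swap_of_eq_off_pair {ι : Type*} [DecidableEq ι] {a b : ι}
    {σ τ : Equiv.Perm ι} (h : ∀ j, j ≠ a → j ≠ b → σ j = τ j) :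
    τ = σ ∨ τ = σ * Equiv.swap a b := by
  have hfix : ∀ j, j ≠ a → j ≠ b → (σ⁻¹ * τ) j = j := fun j ha hb => by
    simp [← h j ha hb]
  have hmem : ∀ j, j = a ∨ j = b → (σ⁻¹ * τ) j = a ∨ (σ⁻¹ * τ) j = b := by
    intro j hj
    by_contra! hne
    have := (σ⁻¹ * τ).injective (hfix _ hne.1 hne.2)
    rw [this] at hne
    tauto
  have hinj : ∀ i j, (σ⁻¹ * τ) i = (σ⁻¹ * τ) j → i = j := fun i j h => (σ⁻¹ * τ).injective h
  have hρ : σ⁻¹ * τ = 1 ∨ σ⁻¹ * τ = Equiv.swap a b := by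
    generalize σ⁻¹ * τ = ρ at *
    rcases hmem a (Or.inl rfl) with ha | ha <;> rcases hmem b (Or.inr rfl) with hb | hb
    · obtain rfl := hinj a b (ha.trans hb.symm)
      left; ext j; by_cases hj : j = a
      · rw [hj, ha]; rfl
      · exact hfix j hj hj
    · left; ext j; by_cases hj : j = a
      · rw [hj, ha]; rfl
      by_cases hj' : j = b
      · rw [hj', hb]; rfl
      exact hfix j hj hj'
    · right; ext j; by_cases hj : j = a
      · rw [hj, ha, Equiv.swap_apply_left]
      by_cases hj' : j = b
      · rw [hj', hb, Equiv.swap_apply_right]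
      rw [Equiv.swap_apply_of_ne_of_ne hj hj', hfix j hj hj']
    · obtain rfl := hinj a b (ha.trans hb.symm)
      left; ext j; by_cases hj : j = a
      · rw [hj, ha]; rfl
      · exact hfix j hj hj
  exact hρ.imp (fun h => by simpa using inv_mul_eq_iff_eq_mul.1 h)
    fun h => inv_mul_eq_iff_eq_mul.1 h

lemma sum_perm_sum_perm_le {ι : Type*} [Fintype ι] [DecidableEq ι] {a b : ι} (hab : a ≠ b)
    {B : ℝ} (M : ι → ι → ι → ℝ)
    (hM : ∀ j, j ≠ a → j ≠ b → ∀ i k, M j i k = if i = k then 1 else 0)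
    (ha : ∀ i k, |M a i k| ≤ B) (hb : ∀ i k, |M b i k| ≤ B) :
    ∑ σ : Equiv.Perm ι, ∑ τ : Equiv.Perm ι,
        ((σ.sign : ℤ) * (τ.sign : ℤ) : ℝ) * ∏ j, M j (σ j) (τ j) ≤
      (Fintype.card ι).factorial * (2 * B ^ 2) := by
  have hB : 0 ≤ B := (abs_nonneg _).trans (ha a a)
  have hsign : ∀ σ : Equiv.Perm ι, |((σ.sign : ℤ) : ℝ)| = 1 := fun σ => by
    rcases Int.units_eq_one_or σ.sign with h | h <;> simp [h]
  have hbound : ∀ σ τ : Equiv.Perm ι,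
      ((σ.sign : ℤ) * (τ.sign : ℤ) : ℝ) * ∏ j, M j (σ j) (τ j) ≤
        if τ ∈ ({σ, σ * Equiv.swap a b} : Finset (Equiv.Perm ι)) then B ^ 2 else 0 := by
    intro σ τ
    by_cases h : ∀ j, j ≠ a → j ≠ b → σ j = τ j
    · rw [if_pos (by simpa using Equiv.Perm.eq_or_eq_mul_swap_of_eq_off_pair h)]
      refine (le_abs_self _).trans ?_
      rw [abs_mul, abs_mul, hsign, hsign, one_mul, one_mul, Finset.abs_prod,
        Finset.prod_eq_mul a b hab (fun j _ hj => by rw [hM j hj.1 hj.2, if_pos (h j hj.1 hj.2),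
          abs_one]) (by simp) (by simp), sq]
      exact mul_le_mul (ha _ _) (hb _ _) (abs_nonneg _) hB
    · push Not at h
      obtain ⟨j, hja, hjb, hj⟩ := h
      rw [Finset.prod_eq_zero (Finset.mem_univ j) (by rw [hM j hja hjb, if_neg hj]), mul_zero]
      positivity
  calc _ ≤ ∑ σ : Equiv.Perm ι, ∑ τ : Equiv.Perm ι,
        if τ ∈ ({σ, σ * Equiv.swap a b} : Finset (Equiv.Perm ι)) then B ^ 2 else 0 :=
        Finset.sum_le_sum fun σ _ => Finset.sum_le_sum fun τ _ => hbound σ τ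
    _ ≤ ∑ _σ : Equiv.Perm ι, 2 * B ^ 2 := by
        refine Finset.sum_le_sum fun σ _ => ?_
        rw [Finset.sum_ite_mem, Finset.univ_inter, Finset.sum_const, nsmul_eq_mul]
        gcongr
        exact_mod_cast Finset.card_le_two
    _ = _ := by simp [Fintype.card_perm]

/-- The squared modulus `|e^{ix} - s|²`. -/
def circleDistSq (s x : ℝ) : ℝ := (1 - s) ^ 2 + 4 * s * sin (x / 2) ^ 2

@[fun_prop]
lemma continuous_circleDistSq (s : ℝ) : Continuous (circleDistSq s) := by
  unfold circleDistSq; fun_prop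

lemma sq_one_sub_le_circleDistSq {s : ℝ} (hs : 0 ≤ s) (x : ℝ) :
    (1 - s) ^ 2 ≤ circleDistSq s x :=
  le_add_of_nonneg_right (by positivity)

lemma circleDistSq_pos {s : ℝ} (hs : 0 ≤ s) (hs' : s < 1) (x : ℝ) : 0 < circleDistSq s x :=
  (pow_pos (sub_pos.2 hs') 2).trans_le (sq_one_sub_le_circleDistSq hs x)

lemma abs_integral_sineFun_div_circleDistSq_le {N : ℕ} {s : ℝ} (hs : 1 / 2 ≤ s) (hs' : s < 1)
    (i k : Fin N) :
    |∫ x in Set.Icc 0 π, (1 - s) ^ 2 / circleDistSq s x * (sineFun i x * sineFun k x)| ≤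
      4 * N ^ 2 * (1 - s) ^ 2 := by
  have hN : ∀ i : Fin N, (2 * (i : ℕ) + 1 : ℝ) ≤ 2 * N := fun i => by
    have : 2 * (i : ℕ) + 1 ≤ 2 * N := by omega
    exact_mod_cast this
  have hpt : ∀ x : ℝ, ‖(1 - s) ^ 2 / circleDistSq s x * (sineFun i x * sineFun k x)‖ ≤
      4 * N ^ 2 * (1 - s) ^ 2 / π := by
    intro x
    have hpos := circleDistSq_pos (by linarith : 0 ≤ s) hs' x
    have hsin : |sin (((i : ℕ) + 1 / 2) * x) * sin (((k : ℕ) + 1 / 2) * x)| ≤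
        2 * N ^ 2 * circleDistSq s x := by
      calc _ ≤ (2 * N * |sin (x / 2)|) * (2 * N * |sin (x / 2)|) := by
            rw [abs_mul]
            have hle : ∀ i : Fin N, |sin (((i : ℕ) + 1 / 2) * x)| ≤ 2 * N * |sin (x / 2)| :=
              fun i => (abs_sin_add_half_mul_le x i).trans
                (mul_le_mul_of_nonneg_right (hN i) (abs_nonneg _))
            exact mul_le_mul (hle i) (hle k) (abs_nonneg _) (by positivity)
        _ = 2 * N ^ 2 * (2 * sin (x / 2) ^ 2) := by rw [← sq_abs (sin (x / 2))]; ring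
        _ ≤ _ := by
            gcongr
            unfold circleDistSq
            nlinarith [sq_nonneg (1 - s), sq_nonneg (sin (x / 2))]
    rw [sineFun_mul_sineFun, norm_eq_abs, abs_mul, abs_mul, abs_of_nonneg (by positivity),
      abs_of_nonneg (by positivity : 0 ≤ 2 / π)]
    calc _ ≤ (1 - s) ^ 2 / circleDistSq s x * (2 / π * (2 * N ^ 2 * circleDistSq s x)) := by
          gcongr
      _ = _ := by field_simp; ring
  have := norm_setIntegral_le_of_norm_le_const (μ := volume) (s := Set.Icc (0 : ℝ) π)
    (by simp) fun x _ => hpt x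
  rw [← norm_eq_abs]
  refine this.trans_eq ?_
  rw [Real.volume_real_Icc_of_le pi_pos.le]
  field_simp
  ring

lemma zpow_neg_circleDistSq_le {s : ℝ} (hs : 0 ≤ s) (hs' : s < 1) (x : ℝ) (m : ℕ) :
    circleDistSq s x ^ (-(m : ℤ)) ≤ ((1 - s) ^ (2 * m))⁻¹ := by
  have : 0 < 1 - s := sub_pos.2 hs'
  rw [zpow_neg, zpow_natCast, pow_mul]
  gcongr
  exact sq_one_sub_le_circleDistSq hs x

lemma densitySO_nonneg (N : ℕ) (θ : Fin N → ℝ) : 0 ≤ densitySO N θ := by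
  rw [densitySO_eq_det_sq]; positivity

/-- Bound on `g(l, s, N)` when at least two distinct exponents `l_j` are equal to `1`. -/
theorem gFun_bound_of_two_ones :
    ∃ C : ℝ, 0 < C ∧ ∀ (N : ℕ), 2 ≤ N → ∀ (s : ℝ), 1 / 2 ≤ s → s < 1 →
      ∀ (n p : ℕ) (l : Fin N → ℕ), p + ∑ j, l j = n →
        (∃ j k : Fin N, j ≠ k ∧ l j = 1 ∧ l k = 1) →
        gFun N l s ≤
          C * ((N : ℝ) ^ 4 * (1 - s) ^ 4 + (N : ℝ) ^ 2 * (1 - s) ^ 3) /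
            (1 - s) ^ (2 * n - 2 * p) := by
  refine ⟨32, by norm_num, ?_⟩
  rintro N - s hs hs' n p l rfl ⟨a, b, hab, hla, hlb⟩
  have hs₀ : 0 ≤ s := by linarith
  have hδ : 0 < 1 - s := sub_pos.2 hs'
  have hexp : 2 * (p + ∑ j, l j) - 2 * p = ∑ j, 2 * l j := by
    rw [← Finset.mul_sum]; omega
  rw [hexp]
  set w : Fin N → ℝ → ℝ := fun j x =>
    if j = a ∨ j = b then (1 - s) ^ 2 / circleDistSq s x else 1 with hw
  set μ : Measure ℝ := volume.restrict (Set.Icc 0 π) with hμ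
  have hwa : w a = fun x => (1 - s) ^ 2 / circleDistSq s x := by simp [hw]
  have hwb : w b = fun x => (1 - s) ^ 2 / circleDistSq s x := by simp [hw]
  have hwcont : ∀ j, Continuous (w j) := by
    intro j
    by_cases hj : j = a ∨ j = b
    · simp only [hw, if_pos hj]
      exact continuous_const.div (continuous_circleDistSq s)
        fun x => (circleDistSq_pos hs₀ hs' x).ne'
    · simp only [hw, if_neg hj]
      exact continuous_const
  obtain ⟨hint, heq⟩ := integral_prod_mul_det_sq (μ := μ) w (fun i : Fin N => sineFun i)
    fun j i k => (((hwcont j).mul ((continuous_sineFun i).mul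
      (continuous_sineFun k))).continuousOn).integrableOn_Icc
  have hsum := sum_perm_sum_perm_le hab
    (fun j i k => ∫ x, w j x * (sineFun i x * sineFun k x) ∂μ)
    (fun j hja hjb i k => by
      simp only [hw, hja, hjb, or_self, if_false, one_mul, hμ]
      rw [integral_sineFun_mul_sineFun]
      simp only [Fin.ext_iff])
    (fun i k => by
      simp only [hwa]
      exact abs_integral_sineFun_div_circleDistSq_le hs hs' i k)
    (fun i k => by
      simp only [hwb]
      exact abs_integral_sineFun_div_circleDistSq_le hs hs' i k)
  rw [← heq, Fintype.card_fin] at hsum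
  have hfactor : ∀ j x, circleDistSq s x ^ (-(l j : ℤ)) ≤ w j x * ((1 - s) ^ (2 * l j))⁻¹ := by
    intro j x
    by_cases hj : j = a ∨ j = b
    · have hl : l j = 1 := by rcases hj with rfl | rfl <;> assumption
      have := circleDistSq_pos hs₀ hs' x
      simp only [hw, if_pos hj, hl]
      apply le_of_eq
      simp only [Nat.cast_one, zpow_neg, zpow_one, mul_one]
      field_simp
    · simp only [hw, if_neg hj, one_mul]
      exact zpow_neg_circleDistSq_le hs₀ hs' x _
  have hpt : ∀ θ : Fin N → ℝ,
      (∏ j, circleDistSq s (θ j) ^ (-(l j : ℤ))) * densitySO N θ ≤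
        ((1 - s) ^ ∑ j, 2 * l j)⁻¹ * (1 / N.factorial) *
          ((∏ j, w j (θ j)) * (Matrix.of fun i j : Fin N => sineFun i (θ j)).det ^ 2) := by
    intro θ
    calc _ ≤ (∏ j, w j (θ j) * ((1 - s) ^ (2 * l j))⁻¹) * densitySO N θ := by
          refine mul_le_mul_of_nonneg_right (Finset.prod_le_prod (fun j _ => ?_)
            fun j _ => hfactor j (θ j)) (densitySO_nonneg N θ)
          exact zpow_nonneg (circleDistSq_pos hs₀ hs' _).le _
      _ = _ := by
          rw [Finset.prod_mul_distrib, Finset.prod_inv_distrib, Finset.prod_pow_eq_pow_sum,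
            densitySO_eq_det_sq]
          ring
  have hmeas : (volume : Measure (Fin N → ℝ)).restrict
      (Set.univ.pi fun _ : Fin N => Set.Icc (0 : ℝ) π) = Measure.pi fun _ => μ :=
    Measure.restrict_pi_pi _ _
  calc gFun N l s
      = ∫ θ, (∏ j, circleDistSq s (θ j) ^ (-(l j : ℤ))) * densitySO N θ
          ∂(Measure.pi fun _ => μ) := by rw [← hmeas]; rfl
    _ ≤ ∫ θ, ((1 - s) ^ ∑ j, 2 * l j)⁻¹ * (1 / N.factorial) *
          ((∏ j, w j (θ j)) * (Matrix.of fun i j : Fin N => sineFun i (θ j)).det ^ 2)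
          ∂(Measure.pi fun _ => μ) :=
        integral_mono_of_nonneg
          (ae_of_all _ fun θ => mul_nonneg (Finset.prod_nonneg fun j _ =>
            zpow_nonneg (circleDistSq_pos hs₀ hs' _).le _) (densitySO_nonneg N θ))
          (hint.const_mul _) (ae_of_all _ hpt)
    _ ≤ ((1 - s) ^ ∑ j, 2 * l j)⁻¹ * (1 / N.factorial) *
          (N.factorial * (2 * (4 * N ^ 2 * (1 - s) ^ 2) ^ 2)) := by
        rw [integral_const_mul]
        gcongr
    _ = 32 * (N ^ 4 * (1 - s) ^ 4) / (1 - s) ^ ∑ j, 2 * l j := by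
        field_simp
        ring
    _ ≤ _ := by
        gcongr
        exact le_add_of_nonneg_right (by positivity)
end
end

section
/- For every real s with 0 ≤ s < 1 and every integer l ≥ 2, ∫_0^π sin²(θ/2) / ((1−s)² + 4s sin²(θ/2))^l dθ ≤ π / ( 2 (1−s)^{2l−3} (1+s)³ ). -/
open Real

/-- The quadratic form `a² cos² + b² sin²` is positive. -/
lemma sq_mul_cos_sq_add_sq_mul_sin_sq_pos {a b : ℝ} (ha : 0 < a) (hb : 0 < b) (x : ℝ) :
    0 < a ^ 2 * cos x ^ 2 + b ^ 2 * sin x ^ 2 := by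
  rcases eq_or_ne (sin x) 0 with h | h
  · have hc : cos x ^ 2 = 1 := by rw [cos_sq', h]; norm_num
    rw [h, hc]
    positivity
  · positivity

/-- The function `x + arctan ((b - a) sin x cos x / (a cos² x + b sin² x))`, a smooth extension of
`arctan ((b / a) tan x)`, is an antiderivative of `a b / (a² cos² x + b² sin² x)`. -/
lemma hasDerivAt_add_arctan_sin_mul_cos_div {a b : ℝ} (ha : 0 < a) (hb : 0 < b) (x : ℝ) :
    HasDerivAt
      (fun t ↦ t + arctan ((b - a) * (sin t * cos t) / (a * cos t ^ 2 + b * sin t ^ 2)))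
      (a * b / (a ^ 2 * cos x ^ 2 + b ^ 2 * sin x ^ 2)) x := by
  have hD := sq_mul_cos_sq_add_sq_mul_sin_sq_pos ha hb x
  have hM : 0 < a * cos x ^ 2 + b * sin x ^ 2 := by
    have h := sq_mul_cos_sq_add_sq_mul_sin_sq_pos (sqrt_pos.2 ha) (sqrt_pos.2 hb) x
    rwa [sq_sqrt ha.le, sq_sqrt hb.le] at h
  have hN := ((hasDerivAt_sin x).mul (hasDerivAt_cos x)).const_mul (b - a)
  have hM' := (((hasDerivAt_cos x).pow 2).const_mul a).add
    (((hasDerivAt_sin x).pow 2).const_mul b)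
  have h := (hasDerivAt_id x).add (hN.div hM' hM.ne').arctan
  refine h.congr_deriv ?_
  have hx : cos x ^ 2 = 1 - sin x ^ 2 := cos_sq' x
  have key : (a * cos x ^ 2 + b * sin x ^ 2) ^ 2 + ((b - a) * (sin x * cos x)) ^ 2
      = a ^ 2 * cos x ^ 2 + b ^ 2 * sin x ^ 2 := by
    rw [mul_pow, mul_pow, hx]
    ring
  have key' : 1 + ((b - a) * (sin x * cos x) / (a * cos x ^ 2 + b * sin x ^ 2)) ^ 2
      = (a ^ 2 * cos x ^ 2 + b ^ 2 * sin x ^ 2) / (a * cos x ^ 2 + b * sin x ^ 2) ^ 2 := by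
    rw [← key]
    field_simp
  simp only [Pi.add_apply, Pi.mul_apply, Pi.pow_apply, Pi.div_apply]
  rw [key']
  field_simp
  simp only [Nat.cast_ofNat, Nat.add_one_sub_one, pow_one]
  linear_combination
    (a * b * (cos x ^ 2 + sin x ^ 2 + 1) - a ^ 2 * cos x ^ 2 - b ^ 2 * sin x ^ 2) * hx

/-- `∫₀^{π/2} sin² / (a² cos² + b² sin²)² = π / (4 a b³)`. -/
lemma integral_sin_sq_div_sq_mul_cos_sq_add_sq_mul_sin_sq_sq {a b : ℝ} (ha : 0 < a) (hb : 0 < b) :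
    ∫ x in (0 : ℝ)..(π / 2), sin x ^ 2 / (a ^ 2 * cos x ^ 2 + b ^ 2 * sin x ^ 2) ^ 2
      = π / (4 * a * b ^ 3) := by
  have hpos := sq_mul_cos_sq_add_sq_mul_sin_sq_pos ha hb
  have hderiv : ∀ x : ℝ, HasDerivAt
      (fun t ↦ (t + arctan ((b - a) * (sin t * cos t) / (a * cos t ^ 2 + b * sin t ^ 2)))
          / (2 * a * b ^ 3)
        - (sin t * cos t) / (a ^ 2 * cos t ^ 2 + b ^ 2 * sin t ^ 2) / (2 * b ^ 2))
      (sin x ^ 2 / (a ^ 2 * cos x ^ 2 + b ^ 2 * sin x ^ 2) ^ 2) x := by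
    intro x
    have hD := hpos x
    have hQ := (((hasDerivAt_cos x).pow 2).const_mul (a ^ 2)).add
      (((hasDerivAt_sin x).pow 2).const_mul (b ^ 2))
    have h := ((hasDerivAt_add_arctan_sin_mul_cos_div ha hb x).div_const (2 * a * b ^ 3)).sub
      ((((hasDerivAt_sin x).mul (hasDerivAt_cos x)).div hQ hD.ne').div_const (2 * b ^ 2))
    refine h.congr_deriv ?_
    have hx : cos x ^ 2 = 1 - sin x ^ 2 := cos_sq' x
    simp only [Pi.add_apply, Pi.mul_apply, Pi.pow_apply]
    field_simp
    simp only [Nat.cast_ofNat, Nat.add_one_sub_one, pow_one]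
    linear_combination (b ^ 2 * sin x ^ 2 - a ^ 2 * cos x ^ 2) * hx
  rw [intervalIntegral.integral_eq_sub_of_hasDerivAt (fun x _ ↦ hderiv x)]
  · simp
    field_simp
    norm_num
  · refine Continuous.intervalIntegrable ?_ _ _
    exact Continuous.div (by fun_prop) (by fun_prop) fun x ↦ (pow_pos (hpos x) 2).ne'

/-- `∫₀^π sin²(θ/2) / ((1-s)² + 4s sin²(θ/2))^l dθ ≤ π / (2(1-s)^{2l-3}(1+s)³)` for
`0 ≤ s < 1` and `l ≥ 2`. -/
theorem integral_sin_sq_div_pow_le (s : ℝ) (hs0 : 0 ≤ s) (hs1 : s < 1) (l : ℕ) (hl : 2 ≤ l) :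
    (∫ θ in (0 : ℝ)..π,
        Real.sin (θ / 2) ^ 2 / ((1 - s) ^ 2 + 4 * s * Real.sin (θ / 2) ^ 2) ^ l) ≤
      π / (2 * (1 - s) ^ (2 * l - 3) * (1 + s) ^ 3) := by
  obtain ⟨k, rfl⟩ := Nat.exists_eq_add_of_le hl
  have ha : 0 < 1 - s := by linarith
  have hb : 0 < 1 + s := by linarith
  have hD (x : ℝ) : 0 < (1 - s) ^ 2 + 4 * s * sin x ^ 2 := by positivity
  have hcont (m : ℕ) : Continuous fun x ↦ sin x ^ 2 / ((1 - s) ^ 2 + 4 * s * sin x ^ 2) ^ m :=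
    Continuous.div (by fun_prop) (by fun_prop) fun x ↦ (pow_pos (hD x) m).ne'
  have hsq : ∫ x in (0 : ℝ)..(π / 2), sin x ^ 2 / ((1 - s) ^ 2 + 4 * s * sin x ^ 2) ^ 2
      = π / (4 * (1 - s) * (1 + s) ^ 3) := by
    rw [← integral_sin_sq_div_sq_mul_cos_sq_add_sq_mul_sin_sq_sq ha hb]
    congr! 4 with x
    rw [cos_sq']
    ring
  have hmono : ∫ x in (0 : ℝ)..(π / 2), sin x ^ 2 / ((1 - s) ^ 2 + 4 * s * sin x ^ 2) ^ (2 + k)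
      ≤ ∫ x in (0 : ℝ)..(π / 2),
        sin x ^ 2 / ((1 - s) ^ 2 + 4 * s * sin x ^ 2) ^ 2 / ((1 - s) ^ 2) ^ k := by
    refine intervalIntegral.integral_mono (by positivity) ((hcont _).intervalIntegrable _ _)
      (((hcont 2).div_const _).intervalIntegrable _ _) fun x ↦ ?_
    have hDx := hD x
    simp only [pow_add, ← div_div]
    gcongr
    have : 0 ≤ 4 * s * sin x ^ 2 := by positivity
    linarith
  rw [intervalIntegral.integral_div, hsq] at hmono
  rw [intervalIntegral.integral_comp_div
    (fun x ↦ sin x ^ 2 / ((1 - s) ^ 2 + 4 * s * sin x ^ 2) ^ (2 + k)) two_ne_zero, zero_div,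
    smul_eq_mul]
  refine (mul_le_mul_of_nonneg_left hmono zero_le_two).trans_eq ?_
  rw [show 2 * (2 + k) - 3 = 2 * k + 1 by omega, pow_succ _ (2 * k), pow_mul]
  field_simp
  norm_num
end

section
/- Let K be a positive real number and let m be an odd integer with m ≥ 3 and m ≥ ⌊K⌋. Then there exists a constant M_{K,m} > 0 such that for all N ≥ 1 and all s ∈ (0,1) with 2(1−s)N/(s+1) ≤ 1/2: for every X ∈ SO(2N+1) the quantity −Λ_X'(s)/Λ_X(s) is positive, and |(1−s)^K ∫_{SO(2N+1)} (−Λ_X'(s)/Λ_X(s))^K dHaar(X) − [ 1 − K N (1−s) − K N (1−s)² + (K(K+1)/2) N² (1−s)² ]| ≤ M_{K,m} ( N^{m+5} (1−s)⁴ + N^{m+3} (1−s)³ ). -/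
open MeasureTheory Real Filter Matrix

noncomputable section

instance matrixMeasurableSpace {m n α : Type*} [MeasurableSpace α] :
    MeasurableSpace (Matrix m n α) :=
  (inferInstance : MeasurableSpace (m → n → α))

/-- The special orthogonal group `SO(n)`, realised as the subgroup of the orthogonal group
`O(n)` consisting of matrices of determinant one. -/
def SOsub (n : ℕ) : Subgroup (Matrix.orthogonalGroup (Fin n) ℝ) where
  carrier := {X | (X : Matrix (Fin n) (Fin n) ℝ).det = 1}
  one_mem' := by simp
  mul_mem' := by
    intro a b ha hb
    simp only [Set.mem_setOf_eq] at *
    simp [Matrix.det_mul, ha, hb]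
  inv_mem' := by
    intro a ha
    simp only [Set.mem_setOf_eq] at *
    have h : ((a⁻¹ * a : Matrix.orthogonalGroup (Fin n) ℝ) : Matrix (Fin n) (Fin n) ℝ) = 1 := by
      simp
    have := congrArg Matrix.det h
    simp only [MulMemClass.coe_mul, Matrix.det_mul, ha, mul_one, Matrix.det_one] at this
    exact this

/-- The group `SO(2N+1)`. -/
abbrev SOodd (N : ℕ) := ↥(SOsub (2 * N + 1))

/-- The matrix underlying an element of `SO(2N+1)`. -/
def mat {N : ℕ} (X : SOodd N) : Matrix (Fin (2 * N + 1)) (Fin (2 * N + 1)) ℝ :=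
  ((X : Matrix.orthogonalGroup (Fin (2 * N + 1)) ℝ) : Matrix (Fin (2 * N + 1)) (Fin (2 * N + 1)) ℝ)

/-- The characteristic polynomial `Λ_X(s) = det(I - s Xᵀ)` of `X ∈ SO(2N+1)`. -/
def charPoly {N : ℕ} (X : SOodd N) (s : ℝ) : ℝ :=
  (1 - s • (mat X)ᵀ).det

instance borelSpace_matrix {m n : Type*} [Countable m] [Countable n] :
    BorelSpace (Matrix m n ℝ) :=
  inferInstanceAs (BorelSpace (m → n → ℝ))

instance borelSpace_orthogonalGroup (n : ℕ) : BorelSpace (Matrix.orthogonalGroup (Fin n) ℝ) :=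
  Subtype.borelSpace _

instance borelSpace_SOodd (N : ℕ) : BorelSpace (SOodd N) :=
  Subtype.borelSpace _

section Group

variable {N : ℕ}

lemma continuous_mat : Continuous (mat : SOodd N → _) :=
  continuous_subtype_val.comp continuous_subtype_val

lemma mat_mul_transpose (X : SOodd N) : mat X * (mat X)ᵀ = 1 :=
  (Matrix.mem_orthogonalGroup_iff (Fin (2 * N + 1)) ℝ).1 X.1.2

lemma transpose_mul_mat (X : SOodd N) : (mat X)ᵀ * mat X = 1 :=
  (Matrix.mem_orthogonalGroup_iff' (Fin (2 * N + 1)) ℝ).1 X.1.2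

lemma det_mat (X : SOodd N) : (mat X).det = 1 := X.2

/-- An orthogonal matrix of determinant one, as an element of `SO(2N+1)`. -/
def ofOrthogonal (Y : Matrix (Fin (2 * N + 1)) (Fin (2 * N + 1)) ℝ) (hY : Y * Yᵀ = 1)
    (hdet : Y.det = 1) : SOodd N :=
  ⟨⟨Y, (Matrix.mem_orthogonalGroup_iff (Fin (2 * N + 1)) ℝ).2 hY⟩, hdet⟩

instance compactSpace_SOodd : CompactSpace (SOodd N) := by
  have hemb : Topology.IsEmbedding (mat : SOodd N → _) :=
    Topology.IsEmbedding.subtypeVal.comp Topology.IsEmbedding.subtypeVal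
  have hrange : Set.range (mat : SOodd N → _) =
      {Y : Matrix (Fin (2 * N + 1)) (Fin (2 * N + 1)) ℝ | Y * Yᵀ = 1 ∧ Y.det = 1} := by
    ext Y
    constructor
    · rintro ⟨X, rfl⟩
      exact ⟨mat_mul_transpose X, det_mat X⟩
    · rintro ⟨h1, h2⟩
      exact ⟨ofOrthogonal Y h1 h2, rfl⟩
  have hclosed : IsClosed (Set.range (mat : SOodd N → _)) := by
    rw [hrange]
    exact (isClosed_eq (by fun_prop) continuous_const).inter
      (isClosed_eq (by fun_prop) continuous_const)
  have hbox : IsCompact (Set.univ.pi fun _ : Fin (2 * N + 1) =>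
      Set.univ.pi fun _ : Fin (2 * N + 1) => Set.Icc (-1 : ℝ) 1) :=
    isCompact_univ_pi fun _ => isCompact_univ_pi fun _ => isCompact_Icc
  have hcompact : IsCompact (Set.range (mat : SOodd N → _)) := by
    refine hbox.of_isClosed_subset hclosed ?_
    rintro _ ⟨X, rfl⟩ i - j -
    exact abs_le.1 (entry_norm_bound_of_unitary X.1.2 i j)
  rw [← isCompact_univ_iff, hemb.isCompact_iff, Set.image_univ]
  exact hcompact

lemma integrable_of_continuous (μ : Measure (SOodd N)) [IsFiniteMeasure μ] {f : SOodd N → ℝ}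
    (hf : Continuous f) : Integrable f μ :=
  hf.integrable_of_hasCompactSupport (HasCompactSupport.of_compactSpace f)

section Exponential

open NormedSpace

lemma exp_mul_transpose_of_skew {A : Matrix (Fin (2 * N + 1)) (Fin (2 * N + 1)) ℝ}
    (hA : Aᵀ = -A) : exp A * (exp A)ᵀ = 1 := by
  rw [← Matrix.exp_transpose, hA, ← Matrix.exp_add_of_commute _ _ ((Commute.refl A).neg_right)]
  simp

lemma det_exp_of_skew {A : Matrix (Fin (2 * N + 1)) (Fin (2 * N + 1)) ℝ}
    (hA : Aᵀ = -A) : (exp A).det = 1 := by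
  set B : Matrix (Fin (2 * N + 1)) (Fin (2 * N + 1)) ℝ := (1 / 2 : ℝ) • A with hB
  have hBs : Bᵀ = -B := by rw [hB, Matrix.transpose_smul, hA, smul_neg]
  have h1 : (exp B).det * (exp B).det = 1 := by
    have := congrArg Matrix.det (exp_mul_transpose_of_skew hBs)
    rwa [Matrix.det_mul, Matrix.det_transpose, Matrix.det_one] at this
  have h2 : A = B + B := by rw [hB, ← add_smul]; norm_num
  rw [h2, Matrix.exp_add_of_commute _ _ rfl, Matrix.det_mul, h1]

/-- The exponential of a skew-symmetric matrix as an element of `SO(2N+1)`. -/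
def expSkew (A : Matrix (Fin (2 * N + 1)) (Fin (2 * N + 1)) ℝ) (hA : Aᵀ = -A) : SOodd N :=
  ofOrthogonal (exp A) (exp_mul_transpose_of_skew hA) (det_exp_of_skew hA)

/-- Invariance of Haar measure: the infinitesimal variation of a function along a one-parameter
subgroup has vanishing mean. -/
lemma integral_variation_eq_zero (μ : Measure (SOodd N)) [μ.IsHaarMeasure]
    {A : Matrix (Fin (2 * N + 1)) (Fin (2 * N + 1)) ℝ} (hA : Aᵀ = -A)
    {f f' : Matrix (Fin (2 * N + 1)) (Fin (2 * N + 1)) ℝ → ℝ}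
    (hf : Continuous fun X : SOodd N => f (mat X))
    (hf' : Continuous fun X : SOodd N => f' (mat X))
    (hd : ∀ X : SOodd N, HasDerivAt (fun t : ℝ => f (exp (t • A) * mat X)) (f' (mat X)) 0) :
    ∫ X, f' (mat X) ∂μ = 0 := by
  have hskew : ∀ t : ℝ, (t • A)ᵀ = -(t • A) := fun t => by
    rw [Matrix.transpose_smul, hA, smul_neg]
  let γ : ℝ → SOodd N := fun t => expSkew (t • A) (hskew t)
  have hγ : ∀ t (X : SOodd N), mat (γ t * X) = exp (t • A) * mat X := fun _ _ => rfl
  have hderiv : ∀ (X : SOodd N) (t : ℝ),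
      HasDerivAt (fun t : ℝ => f (mat (γ t * X))) (f' (mat (γ t * X))) t := by
    intro X t
    have h := hd (γ t * X)
    rw [← sub_self t] at h
    refine (h.comp_sub_const t t).congr_of_eventuallyEq (Eventually.of_forall fun r => ?_)
    have : r • A = (r - t) • A + t • A := by rw [← add_smul, sub_add_cancel]
    simp only [hγ]
    rw [this, Matrix.exp_add_of_commute _ _
      ((Commute.refl A).smul_left _ |>.smul_right _), Matrix.mul_assoc]
  obtain ⟨C, hC⟩ := isCompact_univ.exists_bound_of_continuousOn hf'.continuousOn
  have key := hasDerivAt_integral_of_dominated_loc_of_deriv_le (μ := μ) (x₀ := (0 : ℝ))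
    (F := fun t X => f (mat (γ t * X))) (F' := fun t X => f' (mat (γ t * X)))
    (bound := fun _ => C) Filter.univ_mem
    (Eventually.of_forall fun t =>
      (hf.comp (continuous_const_mul (γ t))).aestronglyMeasurable)
    (integrable_of_continuous μ (hf.comp (continuous_const_mul (γ 0))))
    (hf'.comp (continuous_const_mul (γ 0))).aestronglyMeasurable
    (Eventually.of_forall fun X t _ => hC _ (Set.mem_univ _))
    (integrable_const C)
    (Eventually.of_forall fun X t _ => hderiv X t)
  have hconst : (fun t : ℝ => ∫ X, f (mat (γ t * X)) ∂μ) = fun _ => ∫ X, f (mat X) ∂μ := by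
    funext t
    exact integral_mul_left_eq_self (fun X => f (mat X)) (γ t)
  have h0 := key.2
  rw [hconst] at h0
  rw [← integral_mul_left_eq_self (fun X => f' (mat X)) (γ 0)]
  exact h0.unique (hasDerivAt_const _ _)

end Exponential

end Group

section Palindromic

open Polynomial

/-- A palindromic polynomial of formal degree `2N` is `x ^ N * Q (x + x⁻¹)`. -/
lemma exists_eval_add_inv_of_reflect_eq (N : ℕ) (p : ℝ[X]) (hdeg : p.natDegree ≤ 2 * N)
    (hp : p.reflect (2 * N) = p) :
    ∃ Q : ℝ[X], ∀ x : ℝ, x ≠ 0 → p.eval x = x ^ N * Q.eval (x + x⁻¹) := by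
  induction N generalizing p with
  | zero =>
    refine ⟨p, fun x _ => ?_⟩
    obtain ⟨c, rfl⟩ : ∃ c, p = C c := ⟨_, eq_C_of_natDegree_le_zero (by simpa using hdeg)⟩
    simp
  | succ N ih =>
    set a := p.coeff 0 with ha
    set q : ℝ[X] := p - C a * (X ^ 2 + 1) ^ (N + 1) with hq
    have hdegX : ((X ^ 2 + 1 : ℝ[X]) ^ (N + 1)).natDegree ≤ 2 * (N + 1) := by
      refine natDegree_pow_le.trans ?_
      rw [mul_comm]
      gcongr
      compute_degree
    have hreflX : ∀ k : ℕ, ((X ^ 2 + 1 : ℝ[X]) ^ k).reflect (2 * k) = (X ^ 2 + 1) ^ k := by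
      intro k
      induction k with
      | zero => simp [reflect_one]
      | succ k ihk =>
        have h1 : ((X ^ 2 + 1 : ℝ[X]) ^ k).natDegree ≤ 2 * k := by
          refine natDegree_pow_le.trans ?_
          rw [mul_comm]
          gcongr
          compute_degree
        rw [pow_succ, mul_add, mul_one, reflect_mul _ _ h1 (by compute_degree), ihk]
        congr 1
        rw [reflect_add, reflect_one, ← one_mul (X ^ 2 : ℝ[X]), ← C_1, reflect_C_mul_X_pow]
        simp [revAt_le (le_refl 2), add_comm]
    have hqdeg : q.natDegree ≤ 2 * (N + 1) :=
      (natDegree_sub_le_of_le hdeg ((natDegree_C_mul_le _ _).trans hdegX)).trans (max_self _).le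
    have hqrefl : q.reflect (2 * (N + 1)) = q := by
      rw [hq, reflect_sub, hp, reflect_C_mul, hreflX]
    have hq0 : q.coeff 0 = 0 := by
      simp [hq, coeff_zero_eq_eval_zero, ha]
    have hqtop : q.coeff (2 * N + 2) = 0 := by
      have := congrArg (fun r => r.coeff (2 * N + 2)) hqrefl
      simp only [coeff_reflect] at this
      rw [← this, show 2 * (N + 1) = 2 * N + 2 by ring, revAt_le le_rfl, Nat.sub_self, hq0]
    obtain ⟨r, hr⟩ := X_dvd_iff.2 hq0
    have hrcoeff : ∀ k, r.coeff k = q.coeff (k + 1) := fun k => by rw [hr, coeff_X_mul]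
    have hrdeg : r.natDegree ≤ 2 * N := by
      rw [natDegree_le_iff_coeff_eq_zero]
      intro k hk
      rw [hrcoeff]
      rcases Nat.lt_or_ge (2 * N + 1) k with h | h
      · exact coeff_eq_zero_of_natDegree_lt (by omega)
      · rw [show k + 1 = 2 * N + 2 by omega, hqtop]
    have hrrefl : r.reflect (2 * N) = r := by
      ext k
      rw [coeff_reflect]
      rcases Nat.lt_or_ge (2 * N) k with h | h
      · rw [revAt_eq_self_of_lt h]
      · rw [revAt_le h, hrcoeff, hrcoeff]
        conv_rhs => rw [← hqrefl]
        rw [coeff_reflect, revAt_le (by omega)]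
        congr 1
        omega
    obtain ⟨Q, hQ⟩ := ih r hrdeg hrrefl
    refine ⟨Q + C a * X ^ (N + 1), fun x hx => ?_⟩
    have hpq : p = X * r + C a * (X ^ 2 + 1) ^ (N + 1) := by rw [← hr, hq]; ring
    have hx2 : x ^ 2 + 1 = x * (x + x⁻¹) := by field_simp
    rw [hpq]
    simp only [eval_add, eval_mul, eval_X, eval_C, eval_pow, eval_one]
    rw [hQ x hx, hx2, mul_pow]
    ring

end Palindromic

section Spectrum

open Polynomial

variable {N : ℕ}

lemma isHermitian_add_transpose {n : Type*} (Y : Matrix n n ℝ) : (Y + Yᵀ).IsHermitian := by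
  rw [Matrix.IsHermitian, Matrix.conjTranspose_eq_transpose_of_trivial, Matrix.transpose_add,
    Matrix.transpose_transpose, add_comm]

lemma abs_eigenvalues_add_transpose_le {n : Type*} [Fintype n] [DecidableEq n]
    {Y : Matrix n n ℝ} (hY : Yᵀ * Y = 1) (i : n) :
    |(isHermitian_add_transpose Y).eigenvalues i| ≤ 2 := by
  set hA := isHermitian_add_transpose Y
  set v : n → ℝ := ⇑(hA.eigenvectorBasis i) with hv
  have hmul : (Y + Yᵀ) *ᵥ v = hA.eigenvalues i • v := hA.mulVec_eigenvectorBasis i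
  have hvv : 0 < v ⬝ᵥ v := by
    have : v ≠ 0 := by
      intro h
      have h1 := hA.eigenvectorBasis.orthonormal.1 i
      have : hA.eigenvectorBasis i = 0 := by
        ext j
        exact congrFun h j
      rw [this, norm_zero] at h1
      exact zero_ne_one h1
    have hnn : 0 ≤ v ⬝ᵥ v := Finset.sum_nonneg fun j _ => mul_self_nonneg (v j)
    exact lt_of_le_of_ne hnn fun h => this (dotProduct_self_eq_zero.1 h.symm)
  have hYv : (Y *ᵥ v) ⬝ᵥ (Y *ᵥ v) = v ⬝ᵥ v := by
    rw [Matrix.dotProduct_mulVec, ← Matrix.mulVec_transpose, Matrix.mulVec_mulVec, hY,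
      Matrix.one_mulVec]
  have hvY : v ⬝ᵥ ((Y + Yᵀ) *ᵥ v) = 2 * (v ⬝ᵥ (Y *ᵥ v)) := by
    rw [Matrix.add_mulVec, dotProduct_add, Matrix.mulVec_transpose, dotProduct_comm v (v ᵥ* Y),
      ← Matrix.dotProduct_mulVec]
    ring
  have heig : hA.eigenvalues i * (v ⬝ᵥ v) = 2 * (v ⬝ᵥ (Y *ᵥ v)) := by
    rw [← hvY, hmul, dotProduct_smul, smul_eq_mul]
  have hplus : 0 ≤ (v + Y *ᵥ v) ⬝ᵥ (v + Y *ᵥ v) :=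
    Finset.sum_nonneg fun j _ => mul_self_nonneg _
  have hminus : 0 ≤ (v - Y *ᵥ v) ⬝ᵥ (v - Y *ᵥ v) :=
    Finset.sum_nonneg fun j _ => mul_self_nonneg _
  simp only [add_dotProduct, dotProduct_add, sub_dotProduct, dotProduct_sub, hYv,
    dotProduct_comm (Y *ᵥ v) v] at hplus hminus
  rw [abs_le]
  constructor <;> nlinarith

/-- For `Y ∈ SO(2N+1)` the spectrum of `Y + Yᵀ` consists of `2` and of `N` pairs of equal
numbers `y j ∈ [-2, 2]`, which determine the characteristic polynomial of `Y`. -/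
lemma exists_spectrum {Y : Matrix (Fin (2 * N + 1)) (Fin (2 * N + 1)) ℝ} (hY : Y * Yᵀ = 1)
    (hdet : Y.det = 1) :
    ∃ (y : Fin N → ℝ) (a : ℝ), a ≠ 0 ∧ (∀ j, |y j| ≤ 2) ∧
      (∀ s : ℝ, s ≠ 0 → (1 - s • Y).det = a * ((1 - s) * ∏ j, (1 + s ^ 2 - s * y j))) ∧
      ∀ F : ℝ → ℝ, ∑ i, F ((isHermitian_add_transpose Y).eigenvalues i) =
        F 2 + 2 * ∑ j, F (y j) := by
  have hY' : Yᵀ * Y = 1 := mul_eq_one_comm.1 hY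
  have hdetT : ∀ x : ℝ, (1 - x • Yᵀ).det = (1 - x • Y).det := fun x => by
    rw [← Matrix.det_transpose]; simp
  have hcard : Fintype.card (Fin (2 * N + 1)) = 2 * N + 1 := Fintype.card_fin _
  have hscalar : ∀ x : ℝ, Matrix.scalar (Fin (2 * N + 1)) x = x • 1 := fun x => by
    rw [Matrix.scalar_apply, Matrix.smul_one_eq_diagonal]
  have hχ : ∀ x : ℝ, Y.charpoly.eval x = -(1 - x • Y).det := by
    intro x
    have : x • 1 - Y = (-(1 - x • Yᵀ)) * Y := by
      rw [neg_sub, Matrix.sub_mul, Matrix.smul_mul, hY', Matrix.one_mul]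
    rw [Matrix.eval_charpoly, hscalar, this, Matrix.det_mul, hdet, Matrix.det_neg, hcard, hdetT]
    simp [pow_succ, pow_mul]
  have hsmul : ∀ (x : ℝ) (Z : Matrix (Fin (2 * N + 1)) (Fin (2 * N + 1)) ℝ),
      x ^ (2 * N + 1) * Z.det = (x • Z).det := fun x Z => by rw [Matrix.det_smul, hcard]
  have hχ' : ∀ x : ℝ, x ≠ 0 → x ^ (2 * N + 1) * Y.charpoly.eval x⁻¹ = (1 - x • Y).det := by
    intro x hx
    rw [Matrix.eval_charpoly, hscalar, hsmul, smul_sub, smul_smul, mul_inv_cancel₀ hx, one_smul]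
  have hχdeg : Y.charpoly.natDegree = 2 * N + 1 := by
    rw [Matrix.charpoly_natDegree_eq_dim, hcard]
  have hinf : ∀ p q : ℝ[X], (∀ x : ℝ, x ≠ 0 → p.eval x = q.eval x) → p = q := by
    intro p q h
    refine eq_of_infinite_eval_eq p q (Set.Infinite.mono (s := {0}ᶜ) ?_
      (Set.finite_singleton (0 : ℝ)).infinite_compl)
    intro x hx
    exact h x hx
  have hrefl : Y.charpoly.reflect (2 * N + 1) = -Y.charpoly := by
    refine hinf _ _ fun x hx => ?_
    let _ : Invertible x⁻¹ := invertibleOfNonzero (inv_ne_zero hx)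
    have h := eval₂_reflect_mul_pow (RingHom.id ℝ) x⁻¹ (2 * N + 1) Y.charpoly hχdeg.le
    rw [eval₂_id, eval₂_id, invOf_eq_inv, inv_inv] at h
    rw [eval_neg, hχ x, neg_neg, ← hχ' x hx, ← h, mul_left_comm, ← mul_pow,
      mul_inv_cancel₀ hx, one_pow, mul_one]
  have hroot : Y.charpoly.IsRoot 1 := by
    have h1 := hχ 1
    have h2 := hχ' 1 one_ne_zero
    rw [inv_one, one_pow, one_mul] at h2
    rw [IsRoot]
    linarith
  obtain ⟨ψ, hψ⟩ := dvd_iff_isRoot.2 hroot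
  have hψ0 : ψ ≠ 0 := by
    rintro rfl
    rw [mul_zero] at hψ
    exact (Matrix.charpoly_monic Y).ne_zero hψ
  have hψdeg : ψ.natDegree ≤ 2 * N := by
    have := hχdeg
    rw [hψ, natDegree_mul (X_sub_C_ne_zero 1) hψ0, natDegree_X_sub_C] at this
    omega
  have hψrefl : ψ.reflect (2 * N) = ψ := by
    have h := hrefl
    rw [hψ, add_comm (2 * N) 1, reflect_mul _ _ (natDegree_X_sub_C_le 1) hψdeg] at h
    have hX : (X - C 1 : ℝ[X]).reflect 1 = -(X - C 1) := by
      rw [reflect_sub, reflect_C, reflect_one_X]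
      simp
    rw [hX, neg_mul, neg_inj] at h
    exact mul_left_cancel₀ (X_sub_C_ne_zero 1) h
  obtain ⟨Q, hQ⟩ := exists_eval_add_inv_of_reflect_eq N ψ hψdeg hψrefl
  have hdetQ : ∀ x : ℝ, x ≠ 0 →
      (1 - x • Y).det = (1 - x) * (x ^ N * Q.eval (x + x⁻¹)) := by
    intro x hx
    have h := hχ x
    rw [hψ, eval_mul, hQ x hx, eval_sub, eval_X, eval_C] at h
    linarith
  set hA := isHermitian_add_transpose Y
  have hcharA : (Y + Yᵀ).charpoly = (X - C 2) * Q * Q := by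
    refine eq_of_infinite_eval_eq _ _ (Set.Infinite.mono (s := Set.Ici (2 : ℝ)) ?_
      (Set.Ici_infinite 2))
    intro t ht
    obtain ⟨x, hx, rfl⟩ : ∃ x : ℝ, x ≠ 0 ∧ x + x⁻¹ = t := by
      have h4 : √(t ^ 2 - 4) ^ 2 = t ^ 2 - 4 := Real.sq_sqrt (by nlinarith [Set.mem_Ici.1 ht])
      have hpos : 0 < (t + √(t ^ 2 - 4)) / 2 := by
        have := Real.sqrt_nonneg (t ^ 2 - 4)
        have := Set.mem_Ici.1 ht
        linarith
      refine ⟨(t + √(t ^ 2 - 4)) / 2, hpos.ne', ?_⟩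
      rw [inv_eq_of_mul_eq_one_right (b := (t - √(t ^ 2 - 4)) / 2) (by nlinarith)]
      ring
    have hprod : x • ((x + x⁻¹) • 1 - (Y + Yᵀ)) = (1 - x • Y) * (1 - x • Yᵀ) := by
      have : x * (x + x⁻¹) = 1 + x * x := by field_simp; ring
      rw [smul_sub, smul_smul, this, Matrix.sub_mul, Matrix.mul_sub, Matrix.mul_sub,
        Matrix.smul_mul, Matrix.smul_mul, Matrix.mul_smul, Matrix.mul_smul, hY, smul_smul]
      simp only [Matrix.one_mul, Matrix.mul_one, add_smul, one_smul, smul_add]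
      abel
    have h1 := hsmul x ((x + x⁻¹) • 1 - (Y + Yᵀ))
    rw [hprod, Matrix.det_mul, hdetT, hdetQ x hx] at h1
    have hxn : x ^ (2 * N + 1) ≠ 0 := pow_ne_zero _ hx
    rw [Set.mem_ofPred_eq]
    rw [Matrix.eval_charpoly, hscalar]
    refine mul_left_cancel₀ hxn (h1.trans ?_)
    simp only [eval_mul, eval_sub, eval_X, eval_C]
    have : x * (x + x⁻¹ - 2) = (1 - x) ^ 2 := by field_simp; ring
    calc _ = (1 - x) ^ 2 * x ^ (2 * N) * (eval (x + x⁻¹) Q * eval (x + x⁻¹) Q) := by ring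
      _ = _ := by rw [← this]; ring
  have hA0 : (Y + Yᵀ).charpoly ≠ 0 := (Matrix.charpoly_monic _).ne_zero
  have hQ0 : Q ≠ 0 := by
    rintro rfl
    rw [mul_zero] at hcharA
    exact hA0 hcharA
  have hsplit : Q.Splits := by
    refine Splits.of_dvd (g := (Y + Yᵀ).charpoly) ?_ hA0 ⟨(X - C 2) * Q, by rw [hcharA]; ring⟩
    rw [hA.charpoly_eq]
    exact Splits.prod fun i _ => Splits.X_sub_C _
  have hXQ0 : (X - C 2) * Q ≠ 0 := mul_ne_zero (X_sub_C_ne_zero 2) hQ0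
  have hroots : (Y + Yᵀ).charpoly.roots = {2} + Q.roots + Q.roots := by
    rw [hcharA, roots_mul (mul_ne_zero hXQ0 hQ0), roots_mul hXQ0, roots_X_sub_C]
  have heig := hA.roots_charpoly_eq_eigenvalues
  have hQcard : Q.roots.card = N := by
    have h1 := congrArg Multiset.card heig
    rw [hroots] at h1
    simp at h1
    omega
  obtain ⟨y, hy⟩ : ∃ y : Fin N → ℝ, Q.roots = Finset.univ.val.map y := by
    obtain ⟨l, hl⟩ := Quot.exists_rep Q.roots
    have hl' : Q.roots = (l : Multiset ℝ) := hl.symm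
    rw [hl', Multiset.coe_card] at hQcard
    subst hQcard
    exact ⟨l.get, by rw [hl', Fin.univ_val_map, List.ofFn_get]⟩
  refine ⟨y, Q.leadingCoeff, leadingCoeff_ne_zero.2 hQ0, fun j => ?_, fun s hs => ?_, fun F => ?_⟩
  · have hj : y j ∈ (Y + Yᵀ).charpoly.roots := by
      rw [hroots, hy]
      simp
    rw [heig, Multiset.mem_map] at hj
    obtain ⟨i, -, hi⟩ := hj
    rw [← hi]
    exact abs_eigenvalues_add_transpose_le hY' i
  · rw [hdetQ s hs]
    have hprod : s ^ N = ∏ _j : Fin N, s := by simp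
    conv_lhs => rw [hsplit.eq_prod_roots]
    rw [hy, Multiset.map_map, eval_mul, eval_C, eval_multiset_prod, Multiset.map_map]
    change (1 - s) * (s ^ N * (Q.leadingCoeff * ∏ j, eval (s + s⁻¹) (X - C (y j)))) = _
    have : s ^ N * ∏ j, eval (s + s⁻¹) (X - C (y j)) = ∏ j, (1 + s ^ 2 - s * y j) := by
      rw [hprod, ← Finset.prod_mul_distrib]
      refine Finset.prod_congr rfl fun j _ => ?_
      simp only [eval_sub, eval_X, eval_C]
      field_simp
      ring
    rw [← this]
    ring
  · have h := congrArg (fun M : Multiset ℝ => (M.map F).sum) (heig.symm.trans hroots)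
    simp only [hy, Multiset.map_add, Multiset.sum_add, Multiset.map_map,
      Multiset.map_singleton, Multiset.sum_singleton] at h
    change ∑ i, F (hA.eigenvalues i) = F 2 + ∑ j, F (y j) + ∑ j, F (y j) at h
    rw [h]
    ring

end Spectrum

section Resolvent

variable {N : ℕ}

/-- The resolvent `(1 - s Y)⁻¹`. -/
def matResolvent {n : Type*} [Fintype n] [DecidableEq n] (s : ℝ) (Y : Matrix n n ℝ) :
    Matrix n n ℝ :=
  (1 - s • Y)⁻¹

lemma det_one_sub_smul_ne_zero {s : ℝ} (hs0 : 0 < s) (hs1 : s < 1) (X : SOodd N) :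
    (1 - s • mat X).det ≠ 0 := by
  obtain ⟨y, a, ha, hy, hdet, -⟩ := exists_spectrum (mat_mul_transpose X) (det_mat X)
  rw [hdet s hs0.ne']
  refine mul_ne_zero ha (mul_ne_zero (by linarith) (Finset.prod_ne_zero_iff.2 fun j _ => ?_))
  have := (abs_le.1 (hy j)).2
  nlinarith [mul_pos (sub_pos.2 hs1) (sub_pos.2 hs1)]

/-- Traces of powers of `(1 + s² - s (Y + Yᵀ))⁻¹` through the spectrum of `Y + Yᵀ`. -/
lemma trace_pow_of_mul_eq_one {n : Type*} [Fintype n] [DecidableEq n] {A B : Matrix n n ℝ}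
    (hA : A.IsHermitian) (s : ℝ) (hpos : ∀ i, 1 + s ^ 2 - s * hA.eigenvalues i ≠ 0)
    (hB : B * ((1 + s ^ 2) • 1 - s • A) = 1) (p : ℕ) :
    (B ^ p).trace = ∑ i, ((1 + s ^ 2 - s * hA.eigenvalues i)⁻¹) ^ p := by
  set φ := Unitary.conjStarAlgAut ℝ (Matrix n n ℝ) hA.eigenvectorUnitary with hφ
  have hspec : A = φ (Matrix.diagonal hA.eigenvalues) := hA.spectral_theorem
  have hC : (1 + s ^ 2) • 1 - s • A =
      φ (Matrix.diagonal fun i => 1 + s ^ 2 - s * hA.eigenvalues i) := by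
    have : (Matrix.diagonal fun i => 1 + s ^ 2 - s * hA.eigenvalues i) =
        (1 + s ^ 2) • (1 : Matrix n n ℝ) - s • Matrix.diagonal hA.eigenvalues := by
      rw [Matrix.smul_one_eq_diagonal, ← Matrix.diagonal_smul, Matrix.diagonal_sub]
      rfl
    rw [this, map_sub, map_smul, map_smul, map_one, ← hspec]
  have hBφ : B = φ (Matrix.diagonal fun i => (1 + s ^ 2 - s * hA.eigenvalues i)⁻¹) := by
    refine left_inv_eq_right_inv hB ?_
    rw [hC, ← map_mul, Matrix.diagonal_mul_diagonal]
    simp only [mul_inv_cancel₀ (hpos _), Matrix.diagonal_one, map_one]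
  have htrace : ∀ M : Matrix n n ℝ, (φ M).trace = M.trace := by
    intro M
    rw [hφ, Unitary.conjStarAlgAut_apply, Matrix.trace_mul_comm, ← Matrix.mul_assoc,
      Unitary.coe_star_mul_self, Matrix.one_mul]
  rw [hBφ, ← map_pow, htrace, Matrix.diagonal_pow, Matrix.trace_diagonal]
  rfl

/-- The trace identity behind the variation of the resolvent trace: `G` plays the role of a
resolvent, `H` of its transpose. -/
lemma trace_variation_eq {n : Type*} [Fintype n] [DecidableEq n] {G : Matrix n n ℝ} {k : ℝ}
    (hcomm : Gᵀ * G = G * Gᵀ) (hsum : G + Gᵀ = 1 + k • (Gᵀ * G)) :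
    (G * (G * G - G)).trace - (Gᵀ * (G * G - G)).trace =
      k / 2 * ((Gᵀ * G).trace - (4 - 2 * k) * ((Gᵀ * G) ^ 2).trace
        + k ^ 2 * ((Gᵀ * G) ^ 3).trace) := by
  set B := Gᵀ * G with hB
  have hBT : Bᵀ = B := by rw [hB, Matrix.transpose_mul, Matrix.transpose_transpose]
  have hGB : G * B = B * G := by
    rw [hB, ← Matrix.mul_assoc, ← hcomm]
  have hGG : G * G = G + k • (G * B) - B := by
    have h := congrArg (fun M => G * M) hsum
    simp only [Matrix.mul_add, Matrix.mul_one, Matrix.mul_smul, ← hcomm] at h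
    rw [eq_sub_iff_add_eq, ← h]
  have htr : ∀ p : ℕ, 2 * (G * B ^ p).trace = (B ^ p).trace + k * (B ^ (p + 1)).trace := by
    intro p
    have hT : (Gᵀ * B ^ p).trace = (G * B ^ p).trace := by
      rw [← Matrix.trace_transpose, Matrix.transpose_mul, Matrix.transpose_pow, hBT,
        Matrix.transpose_transpose, Matrix.trace_mul_comm]
    have h := congrArg (fun M => (M * B ^ p).trace) hsum
    simp only [Matrix.add_mul, Matrix.one_mul, Matrix.smul_mul, Matrix.trace_add,
      Matrix.trace_smul, hT, smul_eq_mul, ← pow_succ'] at h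
    linarith
  have hP : G * G - G = k • (G * B) - B := by rw [hGG]; abel
  have hGGB : G * (G * B) = G * B + k • (G * B ^ 2) - B ^ 2 := by
    rw [← Matrix.mul_assoc, hGG]
    simp only [Matrix.add_mul, Matrix.sub_mul, Matrix.smul_mul, Matrix.mul_assoc, pow_two]
  have hHGB : Gᵀ * (G * B) = B ^ 2 := by rw [← Matrix.mul_assoc, ← hB, pow_two]
  have hHB : (Gᵀ * B).trace = (G * B).trace := by
    rw [← Matrix.trace_transpose, Matrix.transpose_mul, hBT, Matrix.transpose_transpose,
      Matrix.trace_mul_comm]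
  have h1 := htr 1
  have h2 := htr 2
  rw [pow_one] at h1
  rw [hP, Matrix.mul_sub, Matrix.mul_sub, Matrix.mul_smul, Matrix.mul_smul, hGGB, hHGB]
  simp only [Matrix.trace_sub, Matrix.trace_add, Matrix.trace_smul, smul_eq_mul, hHB]
  norm_num at h1 h2
  linear_combination (k / 2) * h1 + (k ^ 2 / 2) * h2

/-- Everything about a rotation that enters the moment computation, expressed through the numbers
`x j = |1 - s exp(i θ_j)|²`. -/
lemma exists_resolvent_data {s : ℝ} (hs0 : 0 < s) (hs1 : s < 1) (X : SOodd N) :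
    ∃ x : Fin N → ℝ, (∀ j, (1 - s) ^ 2 ≤ x j ∧ x j ≤ (1 + s) ^ 2) ∧
      -(logDeriv (charPoly X) s) = 1 / (1 - s) + ((1 - s ^ 2) * ∑ j, (x j)⁻¹ - N) / s ∧
      (matResolvent s (mat X)).trace = N + 1 / (1 - s) + (1 - s ^ 2) * ∑ j, (x j)⁻¹ ∧
      ((matResolvent s (mat X))ᵀ * matResolvent s (mat X)).trace =
        1 / (1 - s) ^ 2 + 2 * ∑ j, (x j)⁻¹ ∧
      (matResolvent s (mat X) *
          (matResolvent s (mat X) * matResolvent s (mat X) - matResolvent s (mat X))).trace -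
        ((matResolvent s (mat X))ᵀ *
          (matResolvent s (mat X) * matResolvent s (mat X) - matResolvent s (mat X))).trace =
        (1 - s ^ 2) * (∑ j, (x j)⁻¹ - 2 * (1 + s ^ 2) * ∑ j, (x j)⁻¹ ^ 2
          + (1 - s ^ 2) ^ 2 * ∑ j, (x j)⁻¹ ^ 3) := by
  obtain ⟨y, a, ha, hy, hdet, hF⟩ := exists_spectrum (mat_mul_transpose X) (det_mat X)
  have hunit : IsUnit (1 - s • mat X).det :=
    isUnit_iff_ne_zero.2 (det_one_sub_smul_ne_zero hs0 hs1 X)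
  set Y := mat X with hYdef
  set G := matResolvent s Y with hG
  have hε : 0 < 1 - s := sub_pos.2 hs1
  have hx : ∀ j, (1 - s) ^ 2 ≤ 1 + s ^ 2 - s * y j ∧ 1 + s ^ 2 - s * y j ≤ (1 + s) ^ 2 := by
    intro j
    have h := abs_le.1 (hy j)
    constructor <;> nlinarith
  have hxpos : ∀ j, 0 < 1 + s ^ 2 - s * y j := fun j => (pow_pos hε 2).trans_le (hx j).1
  have hGl : G * (1 - s • Y) = 1 := Matrix.nonsing_inv_mul _ hunit
  have hGr : (1 - s • Y) * G = 1 := Matrix.mul_nonsing_inv _ hunit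
  have hHl : Gᵀ * (1 - s • Yᵀ) = 1 := by
    have := congrArg Matrix.transpose hGr
    simpa [Matrix.transpose_mul] using this
  have hHr : (1 - s • Yᵀ) * Gᵀ = 1 := by
    have := congrArg Matrix.transpose hGl
    simpa [Matrix.transpose_mul] using this
  have hPP : (1 - s • Y) * (1 - s • Yᵀ) = (1 + s ^ 2) • 1 - s • (Y + Yᵀ) := by
    rw [Matrix.sub_mul, Matrix.mul_sub, Matrix.mul_sub, Matrix.smul_mul, Matrix.smul_mul,
      Matrix.mul_smul, Matrix.mul_smul, hYdef, mat_mul_transpose, smul_smul, pow_two]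
    simp only [Matrix.one_mul, Matrix.mul_one, add_smul, one_smul, smul_add]
    abel
  have hPP' : (1 - s • Yᵀ) * (1 - s • Y) = (1 + s ^ 2) • 1 - s • (Y + Yᵀ) := by
    rw [Matrix.sub_mul, Matrix.mul_sub, Matrix.mul_sub, Matrix.smul_mul, Matrix.smul_mul,
      Matrix.mul_smul, Matrix.mul_smul, hYdef, transpose_mul_mat, smul_smul, pow_two]
    simp only [Matrix.one_mul, Matrix.mul_one, add_smul, one_smul, smul_add]
    abel
  have hB : Gᵀ * G * ((1 + s ^ 2) • 1 - s • (Y + Yᵀ)) = 1 := by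
    rw [← hPP, Matrix.mul_assoc, ← Matrix.mul_assoc G, hGl, Matrix.one_mul, hHl]
  have hB' : ((1 + s ^ 2) • 1 - s • (Y + Yᵀ)) * (G * Gᵀ) = 1 := by
    rw [← hPP', Matrix.mul_assoc, ← Matrix.mul_assoc (1 - s • Y), hGr, Matrix.one_mul, hHr]
  have hcomm : Gᵀ * G = G * Gᵀ := left_inv_eq_right_inv hB hB'
  have hsum : G + Gᵀ = 1 + (1 - s ^ 2) • (Gᵀ * G) := by
    have h1 : Gᵀ * G * ((1 - s • Y) + (1 - s • Yᵀ)) = G + Gᵀ := by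
      rw [Matrix.mul_add, Matrix.mul_assoc, hGl, Matrix.mul_one, hcomm, Matrix.mul_assoc, hHl,
        Matrix.mul_one, add_comm Gᵀ]
    have h2 : (1 - s • Y) + (1 - s • Yᵀ) =
        ((1 + s ^ 2) • 1 - s • (Y + Yᵀ)) + (1 - s ^ 2) • 1 := by
      simp only [add_smul, sub_smul, one_smul, smul_add]
      abel
    rw [← h1, h2, Matrix.mul_add, hB, Matrix.mul_smul, Matrix.mul_one]
  have hpos : ∀ i, 1 + s ^ 2 - s * (isHermitian_add_transpose Y).eigenvalues i ≠ 0 := by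
    intro i
    have := (abs_le.1 (abs_eigenvalues_add_transpose_le (transpose_mul_mat X) i)).2
    have : 0 < 1 + s ^ 2 - s * (isHermitian_add_transpose Y).eigenvalues i := by
      nlinarith [pow_pos hε 2]
    exact this.ne'
  have hβ : ∀ p : ℕ, ((Gᵀ * G) ^ p).trace =
      1 / (1 - s) ^ (2 * p) + 2 * ∑ j, (1 + s ^ 2 - s * y j)⁻¹ ^ p := by
    intro p
    rw [trace_pow_of_mul_eq_one (isHermitian_add_transpose Y) s hpos hB p,
      hF fun z => (1 + s ^ 2 - s * z)⁻¹ ^ p]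
    congr 1
    rw [show 1 + s ^ 2 - s * 2 = (1 - s) ^ 2 by ring, inv_pow, ← pow_mul, one_div]
  have hβ1 := hβ 1
  simp only [pow_one, mul_one] at hβ1
  refine ⟨fun j => 1 + s ^ 2 - s * y j, hx, ?_, ?_, hβ1, ?_⟩
  · have hev : charPoly X =ᶠ[nhds s] fun r => a * ((1 - r) * ∏ j, (1 + r ^ 2 - r * y j)) := by
      filter_upwards [lt_mem_nhds hs0] with r hr
      rw [← hdet r hr.ne', charPoly, ← Matrix.det_transpose]
      simp [hYdef]
    have hd1 : DifferentiableAt ℝ (fun r : ℝ => 1 - r) s := by fun_prop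
    have hdj : ∀ j ∈ Finset.univ, DifferentiableAt ℝ (fun r : ℝ => 1 + r ^ 2 - r * y j) s :=
      fun j _ => by fun_prop
    have hnj : ∀ j ∈ Finset.univ, (fun r : ℝ => 1 + r ^ 2 - r * y j) s ≠ 0 :=
      fun j _ => (hxpos j).ne'
    have hlog : logDeriv (charPoly X) s =
        -1 / (1 - s) + ∑ j, (2 * s - y j) / (1 + s ^ 2 - s * y j) := by
      rw [logDeriv_apply, hev.deriv_eq, hev.eq_of_nhds, ← logDeriv_apply,
        logDeriv_const_mul _ _ ha, logDeriv_mul _ hε.ne'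
          (Finset.prod_ne_zero_iff.2 hnj) hd1 (by fun_prop)]
      congr 1
      · rw [logDeriv_apply]
        simp
      · rw [logDeriv_prod hnj hdj]
        refine Finset.sum_congr rfl fun j _ => ?_
        rw [logDeriv_apply]
        congr 1
        have h : HasDerivAt (fun r : ℝ => 1 + r ^ 2 - r * y j) (2 * s - y j) s := by
          simpa using (((hasDerivAt_id' s).fun_pow 2).const_add 1).fun_sub
            ((hasDerivAt_id' s).mul_const (y j))
        exact h.deriv
    have hterm : ∀ j, (2 * s - y j) / (1 + s ^ 2 - s * y j) =
        (1 - (1 - s ^ 2) * (1 + s ^ 2 - s * y j)⁻¹) / s := by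
      intro j
      have := (hxpos j).ne'
      field_simp
      ring
    rw [hlog, Finset.sum_congr rfl fun j _ => hterm j, ← Finset.sum_div, Finset.sum_sub_distrib,
      ← Finset.mul_sum]
    simp
    ring
  · have h := congrArg Matrix.trace hsum
    rw [Matrix.trace_add, Matrix.trace_transpose, Matrix.trace_add, Matrix.trace_smul, hβ1,
      Matrix.trace_one, Fintype.card_fin, smul_eq_mul] at h
    push_cast at h
    have h2 : (1 - s ^ 2) * (1 / (1 - s) ^ 2) = 2 / (1 - s) - 1 := by
      field_simp
      ring
    linear_combination (1 / 2) * h + (1 / 2) * h2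
  · have hβ2 := hβ 2
    have hβ3 := hβ 3
    rw [trace_variation_eq hcomm hsum, hβ1, hβ2, hβ3]
    have h0 : 1 / (1 - s) ^ 2 - (4 - 2 * (1 - s ^ 2)) * (1 / (1 - s) ^ (2 * 2)) +
        (1 - s ^ 2) ^ 2 * (1 / (1 - s) ^ (2 * 3)) = 0 := by
      field_simp
      ring
    linear_combination ((1 - s ^ 2) / 2) * h0

end Resolvent

section LoopEquation

open NormedSpace

variable {N : ℕ}

section Variation

attribute [local instance] Matrix.linftyOpNormedRing Matrix.linftyOpNormedAlgebra

/-- The variation of the resolvent along a left translation. -/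
lemma hasDerivAt_matResolvent {n : Type*} [Fintype n] [DecidableEq n] {s : ℝ}
    {Y : Matrix n n ℝ} (A : Matrix n n ℝ) (hdet : (1 - s • Y).det ≠ 0) :
    HasDerivAt (fun t : ℝ => matResolvent s (exp (t • A) * Y))
      (matResolvent s Y * A * (matResolvent s Y - 1)) 0 := by
  have hexp : HasDerivAt (fun t : ℝ => 1 - s • (exp (t • A) * Y)) (-(s • (A * Y))) 0 := by
    have h := hasDerivAt_exp_smul_const (𝕂 := ℝ) A 0
    rw [zero_smul, NormedSpace.exp_zero, one_mul] at h
    exact ((h.mul_const Y).const_smul s).const_sub 1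
  have hunit : IsUnit (1 - s • Y) :=
    (Matrix.isUnit_iff_isUnit_det _).2 (isUnit_iff_ne_zero.2 hdet)
  obtain ⟨u, hu⟩ := hunit
  have hGu : matResolvent s Y = ((u⁻¹ : (Matrix n n ℝ)ˣ) : Matrix n n ℝ) := by
    rw [matResolvent, ← hu, Matrix.coe_units_inv]
  have h0 : (1 : Matrix n n ℝ) - s • (exp ((0 : ℝ) • A) * Y) = u := by
    rw [zero_smul, NormedSpace.exp_zero, one_mul, hu]
  have hinv := hasFDerivAt_ringInverse (𝕜 := ℝ) u
  rw [← h0] at hinv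
  have h := hinv.comp_hasDerivAt (0 : ℝ) hexp
  have hG1 : s • Y * matResolvent s Y = matResolvent s Y - 1 := by
    have : (1 - s • Y) * matResolvent s Y = 1 :=
      Matrix.mul_nonsing_inv _ (isUnit_iff_ne_zero.2 hdet)
    rw [sub_mul, one_mul] at this
    rw [← this]
    abel
  have hval : (-ContinuousLinearMap.mulLeftRight ℝ (Matrix n n ℝ) ↑u⁻¹ ↑u⁻¹) (-(s • (A * Y))) =
      matResolvent s Y * A * (matResolvent s Y - 1) := by
    rw [← hG1, ← hGu]
    simp [mul_assoc]
  rw [hval] at h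
  refine h.congr_of_eventuallyEq (Eventually.of_forall fun t => ?_)
  simp [matResolvent, Matrix.nonsing_inv_eq_ringInverse]

end Variation

lemma hasDerivAt_matResolvent_apply {n : Type*} [Fintype n] [DecidableEq n] {s : ℝ}
    {Y : Matrix n n ℝ} (A : Matrix n n ℝ) (hdet : (1 - s • Y).det ≠ 0) (i j : n) :
    HasDerivAt (fun t : ℝ => matResolvent s (exp (t • A) * Y) i j)
      ((matResolvent s Y * A * (matResolvent s Y - 1)) i j) 0 :=
  hasDerivAt_pi.1 (hasDerivAt_pi.1 (hasDerivAt_matResolvent A hdet) i) j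

lemma continuous_matResolvent {s : ℝ} (hs0 : 0 < s) (hs1 : s < 1) :
    Continuous fun X : SOodd N => matResolvent s (mat X) := by
  have hc : Continuous fun X : SOodd N => 1 - s • mat X :=
    continuous_const.sub (continuous_mat.const_smul s)
  have : (fun X : SOodd N => matResolvent s (mat X)) =
      fun X => ((1 - s • mat X).det)⁻¹ • (1 - s • mat X).adjugate := by
    funext X
    rw [matResolvent, Matrix.inv_def, Ring.inverse_eq_inv]
  rw [this]
  exact (hc.matrix_det.inv₀ (det_one_sub_smul_ne_zero hs0 hs1)).smul hc.matrix_adjugate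

/-- The sum `∑ⱼ |1 - s exp(i θⱼ)|⁻²` over the conjugate pairs of eigenvalues, recovered from the
trace of the resolvent. -/
def pairSum (N : ℕ) (s : ℝ) (Y : Matrix (Fin (2 * N + 1)) (Fin (2 * N + 1)) ℝ) : ℝ :=
  ((matResolvent s Y).trace - N - 1 / (1 - s)) / (1 - s ^ 2)

/-- The total squared variation of `pairSum`, up to normalisation. -/
def pairVariation (N : ℕ) (s : ℝ) (Y : Matrix (Fin (2 * N + 1)) (Fin (2 * N + 1)) ℝ) : ℝ :=
  ((matResolvent s Y * (matResolvent s Y * matResolvent s Y - matResolvent s Y)).trace -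
    ((matResolvent s Y)ᵀ * (matResolvent s Y * matResolvent s Y - matResolvent s Y)).trace) /
      (1 - s ^ 2)

lemma continuous_pairSum {s : ℝ} (hs0 : 0 < s) (hs1 : s < 1) :
    Continuous fun X : SOodd N => pairSum N s (mat X) := by
  have h := (continuous_matResolvent (N := N) hs0 hs1).matrix_trace
  unfold pairSum
  fun_prop

lemma exists_pairSum_eq {s : ℝ} (hs0 : 0 < s) (hs1 : s < 1) (X : SOodd N) :
    ∃ x : Fin N → ℝ, (∀ j, (1 - s) ^ 2 ≤ x j ∧ x j ≤ (1 + s) ^ 2) ∧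
      pairSum N s (mat X) = ∑ j, (x j)⁻¹ ∧
      pairVariation N s (mat X) = ∑ j, (x j)⁻¹ - 2 * (1 + s ^ 2) * ∑ j, (x j)⁻¹ ^ 2
          + (1 - s ^ 2) ^ 2 * ∑ j, (x j)⁻¹ ^ 3 ∧
      -(logDeriv (charPoly X) s) =
        1 / (1 - s) + ((1 - s ^ 2) * pairSum N s (mat X) - N) / s ∧
      ((matResolvent s (mat X))ᵀ * matResolvent s (mat X)).trace =
        1 / (1 - s) ^ 2 + 2 * pairSum N s (mat X) := by
  obtain ⟨x, hx, hlog, htr, hB, hV⟩ := exists_resolvent_data hs0 hs1 X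
  have hk : 1 - s ^ 2 ≠ 0 := by nlinarith
  have hR : pairSum N s (mat X) = ∑ j, (x j)⁻¹ := by
    rw [pairSum, htr, div_eq_iff hk]
    ring
  refine ⟨x, hx, hR, ?_, by rw [hR, hlog], by rw [hR, hB]⟩
  rw [pairVariation, hV, mul_div_cancel_left₀ _ hk]

lemma pairSum_bounds {s : ℝ} (hs0 : 0 < s) (hs1 : s < 1) (X : SOodd N) :
    N / (1 + s) ^ 2 ≤ pairSum N s (mat X) ∧ pairSum N s (mat X) ≤ N / (1 - s) ^ 2 := by
  obtain ⟨x, hx, hR, -⟩ := exists_pairSum_eq hs0 hs1 X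
  have hε : 0 < 1 - s := sub_pos.2 hs1
  rw [hR, div_eq_mul_inv, div_eq_mul_inv]
  constructor
  · have := Finset.card_nsmul_le_sum Finset.univ (fun j => (x j)⁻¹) ((1 + s) ^ 2)⁻¹ fun j _ =>
      inv_anti₀ ((pow_pos hε 2).trans_le (hx j).1) (hx j).2
    simpa using this
  · have := Finset.sum_le_card_nsmul Finset.univ (fun j => (x j)⁻¹) ((1 - s) ^ 2)⁻¹ fun j _ =>
      inv_anti₀ (pow_pos hε 2) (hx j).1
    simpa using this

lemma pairSum_pos (hN : 1 ≤ N) {s : ℝ} (hs0 : 0 < s) (hs1 : s < 1) (X : SOodd N) :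
    0 < pairSum N s (mat X) := by
  have : (0 : ℝ) < N := by exact_mod_cast hN
  exact (by positivity : (0 : ℝ) < N / (1 + s) ^ 2).trans_le (pairSum_bounds hs0 hs1 X).1

/-- The elementary skew-symmetric matrix `E i j - E j i`. -/
def skewUnit {n : Type*} [DecidableEq n] (i j : n) : Matrix n n ℝ :=
  Matrix.single i j 1 - Matrix.single j i 1

lemma mul_single_mul_apply {n : Type*} [Fintype n] [DecidableEq n] (G H : Matrix n n ℝ)
    (a b i j : n) : (G * Matrix.single a b (1 : ℝ) * H : Matrix n n ℝ) i j = G i a * H b j := by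
  rw [Matrix.mul_apply, Finset.sum_eq_single b]
  · simp
  · intro l _ hl
    simp [Matrix.mul_single_apply_of_ne, hl]
  · simp

/-- Summing the variation of `φ G i j` over the directions `E i j - E j i`. -/
lemma sum_variation_eq {n : Type*} [Fintype n] [DecidableEq n] (G : Matrix n n ℝ) (p q : ℝ) :
    ∑ i, ∑ j, (p * (G * skewUnit i j * (G - 1)).trace * G i j +
      q * (G * skewUnit i j * (G - 1) : Matrix n n ℝ) i j) =
      p * ((G * (G * G - G)).trace - (Gᵀ * (G * G - G)).trace) +
        q * (G.trace * (G.trace - Fintype.card n) - (Gᵀ * G).trace + G.trace) := by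
  have htrace : ∀ i j, (G * skewUnit i j * (G - 1)).trace =
      (G * G - G) j i - (G * G - G) i j := by
    have h : ∀ i j, (G * Matrix.single i j 1 * (G - 1)).trace = (G * G - G) j i := by
      intro i j
      have : G * G - G = (G - 1) * G := by rw [Matrix.sub_mul, Matrix.one_mul]
      rw [this, Matrix.trace, Matrix.mul_apply]
      exact Finset.sum_congr rfl fun l _ => by
        rw [Matrix.diag_apply, mul_single_mul_apply, mul_comm]
    intro i j
    rw [skewUnit, Matrix.mul_sub G, Matrix.sub_mul, Matrix.trace_sub, h, h]
  have hentry : ∀ i j, (G * skewUnit i j * (G - 1) : Matrix n n ℝ) i j =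
      G i i * (G j j - 1) - (G i j * G i j - G i j * (1 : Matrix n n ℝ) i j) := by
    intro i j
    rw [skewUnit, Matrix.mul_sub G, Matrix.sub_mul, Matrix.sub_apply, mul_single_mul_apply,
      mul_single_mul_apply, Matrix.sub_apply, Matrix.sub_apply, Matrix.one_apply_eq,
      mul_sub (G i j)]
  have h1 : (G * (G * G - G)).trace = ∑ i, ∑ j, (G * G - G) j i * G i j :=
    Finset.sum_congr rfl fun i _ => by
      rw [Matrix.diag_apply, Matrix.mul_apply]
      exact Finset.sum_congr rfl fun j _ => mul_comm _ _
  have h2 : (Gᵀ * (G * G - G)).trace = ∑ i, ∑ j, (G * G - G) i j * G i j := by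
    rw [Finset.sum_comm]
    exact Finset.sum_congr rfl fun i _ => by
      rw [Matrix.diag_apply, Matrix.mul_apply]
      exact Finset.sum_congr rfl fun j _ => mul_comm _ _
  have h3 : (Gᵀ * G).trace = ∑ i, ∑ j, G i j * G i j := by
    rw [Finset.sum_comm]
    exact Finset.sum_congr rfl fun i _ => by rw [Matrix.diag_apply, Matrix.mul_apply]; rfl
  have h4 : G.trace = ∑ i, ∑ j, G i j * (1 : Matrix n n ℝ) i j :=
    Finset.sum_congr rfl fun i _ => by simp [Matrix.one_apply]
  have h5 : G.trace * (G.trace - Fintype.card n) = ∑ i, ∑ j, G i i * (G j j - 1) := by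
    rw [← Finset.sum_mul_sum]
    simp [Matrix.trace]
  rw [h5, h1, h2, h3]
  conv_rhs => rw [h4]
  simp only [htrace, hentry, ← Finset.sum_sub_distrib, ← Finset.sum_add_distrib, Finset.mul_sum]
  exact Finset.sum_congr rfl fun i _ => Finset.sum_congr rfl fun j _ => by ring

/-- The loop equation for the resolvent: integration by parts on `SO(2N+1)` applied to
`Φ(R) G i j` in the direction `E i j - E j i`, summed over all entries. -/
lemma integral_loop_eq_zero (hN : 1 ≤ N) {s : ℝ} (hs0 : 0 < s) (hs1 : s < 1)
    (μ : Measure (SOodd N)) [μ.IsHaarMeasure] {Φ Φ' : ℝ → ℝ}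
    (hΦ : ∀ r, 0 < r → HasDerivAt Φ (Φ' r) r) (hΦ' : ContinuousOn Φ' (Set.Ioi 0)) :
    ∫ X, (Φ (pairSum N s (mat X)) * (2 * s * pairSum N s (mat X) +
      (1 - s ^ 2) ^ 2 * pairSum N s (mat X) ^ 2 - N ^ 2) +
      Φ' (pairSum N s (mat X)) * pairVariation N s (mat X)) ∂μ = 0 := by
  have hdet := det_one_sub_smul_ne_zero (N := N) hs0 hs1
  have hcG := continuous_matResolvent (N := N) hs0 hs1
  have hcR := continuous_pairSum (N := N) hs0 hs1
  have hcΦ : Continuous fun X : SOodd N => Φ (pairSum N s (mat X)) :=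
    continuous_iff_continuousAt.2 fun X =>
      ContinuousAt.comp (g := Φ) (hΦ _ (pairSum_pos hN hs0 hs1 X)).continuousAt hcR.continuousAt
  have hcΦ' : Continuous fun X : SOodd N => Φ' (pairSum N s (mat X)) :=
    hΦ'.comp_continuous hcR fun X => pairSum_pos hN hs0 hs1 X
  let F : Fin (2 * N + 1) → Fin (2 * N + 1) →
      Matrix (Fin (2 * N + 1)) (Fin (2 * N + 1)) ℝ → ℝ := fun i j Y =>
    Φ' (pairSum N s Y) *
        ((matResolvent s Y * skewUnit i j * (matResolvent s Y - 1)).trace / (1 - s ^ 2)) *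
          matResolvent s Y i j +
      Φ (pairSum N s Y) * (matResolvent s Y * skewUnit i j * (matResolvent s Y - 1)) i j
  have hAc : ∀ i j, Continuous fun X : SOodd N =>
      matResolvent s (mat X) * skewUnit i j * (matResolvent s (mat X) - 1) := fun i j => by fun_prop
  have hFc : ∀ i j, Continuous fun X : SOodd N => F i j (mat X) := fun i j =>
    ((hcΦ'.mul ((hAc i j).matrix_trace.div_const _)).mul (hcG.matrix_elem i j)).add
      (hcΦ.mul ((hAc i j).matrix_elem i j))
  have hzero : ∀ i j, ∫ X, F i j (mat X) ∂μ = 0 := by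
    intro i j
    refine integral_variation_eq_zero μ (A := skewUnit i j) ?_
      (f := fun Y => Φ (pairSum N s Y) * matResolvent s Y i j)
      (hcΦ.mul (hcG.matrix_elem i j)) (hFc i j) fun X => ?_
    · simp [skewUnit, Matrix.transpose_sub, Matrix.transpose_single]
    · have hent := hasDerivAt_matResolvent_apply (skewUnit i j) (hdet X)
      have htr : HasDerivAt (fun t : ℝ => pairSum N s (exp (t • skewUnit i j) * mat X))
          ((matResolvent s (mat X) * skewUnit i j * (matResolvent s (mat X) - 1)).trace /
            (1 - s ^ 2)) 0 :=
        (((HasDerivAt.fun_sum fun l (_ : l ∈ Finset.univ) => hent l l).sub_const _).sub_const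
          _).div_const _
      have hX0 : exp ((0 : ℝ) • skewUnit i j) * mat X = mat X := by
        rw [zero_smul, NormedSpace.exp_zero, one_mul]
      have hΦc := HasDerivAt.comp (h₂ := Φ) (0 : ℝ)
        (by rw [hX0]; exact hΦ _ (pairSum_pos hN hs0 hs1 X)) htr
      have h := hΦc.fun_mul (hent i j)
      simpa only [Function.comp_apply, hX0] using h
  have hsum : ∫ X, ∑ i, ∑ j, F i j (mat X) ∂μ = 0 := by
    rw [integral_finsetSum _ fun i _ => integrable_of_continuous μ
      (continuous_finsetSum _ fun j _ => hFc i j)]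
    refine Finset.sum_eq_zero fun i _ => ?_
    rw [integral_finsetSum _ fun j _ => integrable_of_continuous μ (hFc i j)]
    exact Finset.sum_eq_zero fun j _ => hzero i j
  rw [← hsum]
  refine integral_congr_ae (Eventually.of_forall fun X => ?_)
  obtain ⟨x, -, -, -, -, hB⟩ := exists_pairSum_eq hs0 hs1 X
  have hk : 1 - s ^ 2 ≠ 0 := by nlinarith
  have hε : 1 - s ≠ 0 := by linarith
  have hg : (matResolvent s (mat X)).trace =
      N + 1 / (1 - s) + (1 - s ^ 2) * pairSum N s (mat X) := by
    rw [pairSum, mul_div_cancel₀ _ hk]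
    ring
  have h := sum_variation_eq (matResolvent s (mat X)) (Φ' (pairSum N s (mat X)) / (1 - s ^ 2))
    (Φ (pairSum N s (mat X)))
  have hF : ∑ i, ∑ j, F i j (mat X) = _ := (Finset.sum_congr rfl fun i _ =>
    Finset.sum_congr rfl fun j _ => by simp only [F]; ring).trans h
  have hV : ((matResolvent s (mat X) *
        (matResolvent s (mat X) * matResolvent s (mat X) - matResolvent s (mat X))).trace -
      ((matResolvent s (mat X))ᵀ *
        (matResolvent s (mat X) * matResolvent s (mat X) - matResolvent s (mat X))).trace) =
      (1 - s ^ 2) * pairVariation N s (mat X) := by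
    rw [pairVariation, mul_div_cancel₀ _ hk]
  simp only [hF, hB, hg, hV, Fintype.card_fin]
  push_cast
  field_simp
  ring

end LoopEquation

section Taylor

lemma abs_le_mul_abs_pow_succ {f f' : ℝ → ℝ} {a b D : ℝ} {p : ℕ} (ha : a ≤ 0) (hb : 0 ≤ b)
    (hD : 0 ≤ D) (hf0 : f 0 = 0) (hf : ∀ v ∈ Set.Icc a b, HasDerivAt f (f' v) v)
    (hf' : ∀ v ∈ Set.Icc a b, |f' v| ≤ D * |v| ^ p) {v : ℝ} (hv : v ∈ Set.Icc a b) :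
    |f v| ≤ D * |v| ^ (p + 1) := by
  have hsub : Set.uIcc 0 v ⊆ Set.Icc a b := Set.uIcc_subset_Icc ⟨ha, hb⟩ hv
  have h := (convex_uIcc (0 : ℝ) v).norm_image_sub_le_of_norm_hasDerivWithin_le
    (f := f) (f' := f') (C := D * |v| ^ p)
    (fun w hw => (hf w (hsub hw)).hasDerivWithinAt)
    (fun w hw => (hf' w (hsub hw)).trans (by
      have : |w| ≤ |v| := by simpa using Set.abs_sub_left_of_mem_uIcc hw
      gcongr))
    Set.left_mem_uIcc Set.right_mem_uIcc
  rw [hf0, sub_zero, sub_zero, Real.norm_eq_abs, Real.norm_eq_abs] at h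
  rw [pow_succ, ← mul_assoc]
  exact h

/-- Second-order Taylor expansion of `(1 + v) ^ K` at `0` with cubic remainder. -/
lemma abs_rpow_one_add_sub_le {K a b D : ℝ} (ha : a ≤ 0) (hb : 0 ≤ b) (ha1 : -1 < a)
    (hD : ∀ v ∈ Set.Icc a b, |K * (K - 1) * (K - 2)| * (1 + v) ^ (K - 3) ≤ D)
    {v : ℝ} (hv : v ∈ Set.Icc a b) :
    |(1 + v) ^ K - 1 - K * v - K * (K - 1) / 2 * v ^ 2| ≤ D * |v| ^ 3 := by
  have hpos : ∀ w ∈ Set.Icc a b, 0 < 1 + w := fun w hw => by linarith [hw.1]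
  have hrpow : ∀ L : ℝ, ∀ w ∈ Set.Icc a b,
      HasDerivAt (fun w : ℝ => (1 + w) ^ L) (L * (1 + w) ^ (L - 1)) w := fun L w hw => by
    simpa using ((hasDerivAt_id' w).const_add 1).rpow_const (p := L) (Or.inl (hpos w hw).ne')
  have hD0 : 0 ≤ D := le_trans (by rw [add_zero, one_rpow]; positivity) (hD 0 ⟨ha, hb⟩)
  have h2 : ∀ w ∈ Set.Icc a b, |K * (K - 1) * ((1 + w) ^ (K - 2) - 1)| ≤ D * |w| ^ 1 :=
    fun w hw => abs_le_mul_abs_pow_succ (p := 0)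
      (f := fun w => K * (K - 1) * ((1 + w) ^ (K - 2) - 1))
      (f' := fun w => K * (K - 1) * (K - 2) * (1 + w) ^ (K - 3)) ha hb hD0 (by simp)
      (fun w hw => by
        refine (((hrpow (K - 2) w hw).sub_const 1).const_mul (K * (K - 1))).congr_deriv ?_
        ring_nf)
      (fun w hw => by
        rw [abs_mul, abs_of_nonneg (rpow_nonneg (hpos w hw).le (K - 3)), pow_zero, mul_one]
        exact hD w hw) hw
  have h1 : ∀ w ∈ Set.Icc a b, |K * (1 + w) ^ (K - 1) - K - K * (K - 1) * w| ≤ D * |w| ^ 2 :=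
    fun w hw => abs_le_mul_abs_pow_succ (p := 1)
      (f := fun w => K * (1 + w) ^ (K - 1) - K - K * (K - 1) * w)
      (f' := fun w => K * (K - 1) * ((1 + w) ^ (K - 2) - 1)) ha hb hD0 (by simp)
      (fun w hw => by
        refine ((((hrpow (K - 1) w hw).const_mul K).sub_const K).fun_sub
          ((hasDerivAt_id' w).const_mul (K * (K - 1)))).congr_deriv ?_
        ring_nf) h2 hw
  exact abs_le_mul_abs_pow_succ (p := 2)
    (f := fun w => (1 + w) ^ K - 1 - K * w - K * (K - 1) / 2 * w ^ 2)
    (f' := fun w => K * (1 + w) ^ (K - 1) - K - K * (K - 1) * w) ha hb hD0 (by simp)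
    (fun w hw => by
      refine ((((hrpow K w hw).sub_const 1).fun_sub ((hasDerivAt_id' w).const_mul K)).fun_sub
        (((hasDerivAt_id' w).fun_pow 2).const_mul (K * (K - 1) / 2))).congr_deriv ?_
      simp
      ring) h1 hv

lemma rpow_sub_three_le {K : ℝ} {m : ℤ} (hm3 : 3 ≤ m) (hmK : ⌊K⌋ ≤ m) (hK : 0 < K) {N : ℕ}
    (hN : 1 ≤ N) {v : ℝ} (hv : v ∈ Set.Icc (-1 / 2 : ℝ) (4 * N)) :
    (1 + v) ^ (K - 3) ≤ (8 + 5 ^ K) * (N : ℝ) ^ (m - 2) := by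
  have hN1 : (1 : ℝ) ≤ N := by exact_mod_cast hN
  have hNm : (1 : ℝ) ≤ (N : ℝ) ^ (m - 2) := one_le_zpow₀ hN1 (by omega)
  have h5 : (0 : ℝ) < 5 ^ K := by positivity
  obtain ⟨hv1, hv2⟩ := hv
  rcases le_total K 3 with h | h
  · calc (1 + v) ^ (K - 3) ≤ (1 / 2 : ℝ) ^ (K - 3) :=
          rpow_le_rpow_of_nonpos (by norm_num) (by linarith) (by linarith)
      _ ≤ (1 / 2 : ℝ) ^ (-3 : ℝ) :=
          rpow_le_rpow_of_exponent_ge (by norm_num) (by norm_num) (by linarith)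
      _ = 8 := by
          rw [show (-3 : ℝ) = ((-3 : ℤ) : ℝ) by norm_num, rpow_intCast]
          norm_num
      _ ≤ (8 + 5 ^ K) * (N : ℝ) ^ (m - 2) := by nlinarith
  · have hKm : K < m + 1 := by
      have := Int.lt_floor_add_one K
      have : (⌊K⌋ : ℝ) ≤ m := by exact_mod_cast hmK
      linarith
    calc (1 + v) ^ (K - 3) ≤ (5 * N : ℝ) ^ (K - 3) :=
          rpow_le_rpow (by linarith) (by linarith) (by linarith)
      _ = (5 : ℝ) ^ (K - 3) * (N : ℝ) ^ (K - 3) := mul_rpow (by norm_num) (by linarith)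
      _ ≤ (5 : ℝ) ^ K * (N : ℝ) ^ (((m - 2 : ℤ) : ℝ)) := by
          gcongr
          · norm_num
          · linarith
          · push_cast
            linarith
      _ ≤ (8 + 5 ^ K) * (N : ℝ) ^ (m - 2) := by
          rw [rpow_intCast]
          nlinarith

end Taylor

section Moments

variable {N : ℕ}

lemma pairVariation_ge {s : ℝ} (hs0 : 0 < s) (hs1 : s < 1) (X : SOodd N) :
    -(4 * s * pairSum N s (mat X) ^ 2) ≤ pairVariation N s (mat X) := by
  obtain ⟨x, hx, hR, hV, -⟩ := exists_pairSum_eq hs0 hs1 X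
  have hw : ∀ j, 0 ≤ (x j)⁻¹ := fun j => inv_nonneg.2 ((sq_nonneg _).trans (hx j).1)
  have h2 : ∑ j, (x j)⁻¹ ^ 2 ≤ (∑ j, (x j)⁻¹) ^ 2 :=
    Finset.sum_sq_le_sq_sum_of_nonneg fun j _ => hw j
  have h1 : -(4 * s) * ∑ j, (x j)⁻¹ ^ 2 ≤ pairVariation N s (mat X) := by
    rw [hV, Finset.mul_sum, Finset.mul_sum, Finset.mul_sum, ← Finset.sum_sub_distrib,
      ← Finset.sum_add_distrib]
    refine Finset.sum_le_sum fun j _ => ?_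
    have e1 : 0 ≤ (x j)⁻¹ * (1 - (1 - s) ^ 2 * (x j)⁻¹) ^ 2 := mul_nonneg (hw j) (sq_nonneg _)
    have e2 : 0 ≤ 4 * s * (1 - s) ^ 2 * (x j)⁻¹ ^ 3 := by
      have := hw j
      positivity
    linarith
  rw [hR]
  nlinarith

lemma continuous_pairVariation {s : ℝ} (hs0 : 0 < s) (hs1 : s < 1) :
    Continuous fun X : SOodd N => pairVariation N s (mat X) := by
  have h := continuous_matResolvent (N := N) hs0 hs1
  have hP : Continuous fun X : SOodd N =>
      matResolvent s (mat X) * matResolvent s (mat X) - matResolvent s (mat X) := by fun_prop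
  exact ((h.matrix_mul hP).matrix_trace.sub
    (h.matrix_transpose.matrix_mul hP).matrix_trace).div_const _

lemma integral_pairSum_add (hN : 1 ≤ N) {s : ℝ} (hs0 : 0 < s) (hs1 : s < 1)
    (μ : Measure (SOodd N)) [μ.IsHaarMeasure] [IsProbabilityMeasure μ] :
    2 * s * ∫ X, pairSum N s (mat X) ∂μ +
      (1 - s ^ 2) ^ 2 * ∫ X, pairSum N s (mat X) ^ 2 ∂μ = N ^ 2 := by
  have hcR := continuous_pairSum (N := N) hs0 hs1
  have h := integral_loop_eq_zero hN hs0 hs1 μ (Φ := fun _ => 1) (Φ' := fun _ => 0)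
    (fun r _ => hasDerivAt_const r 1) continuousOn_const
  simp only [one_mul, zero_mul, add_zero] at h
  rw [integral_sub (integrable_of_continuous μ (by fun_prop)) (integrable_const _),
    integral_add (integrable_of_continuous μ (by fun_prop))
      (integrable_of_continuous μ (by fun_prop)), integral_const_mul, integral_const_mul] at h
  simp only [integral_const, probReal_univ, one_smul] at h
  linarith

lemma loop_integrand_ge {r ε s α c k V : ℝ} (hr : 0 < r) (hε : 0 < ε) (hs : 0 < s) (hα : 0 ≤ α)
    (hc : 0 ≤ c) (hαr : 2 * α * (ε * r) ≤ 1) (hk : 4 * s * ε ^ 2 ≤ k)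
    (hV : -(4 * s * r ^ 4) ≤ V) :
    2 * s * α * r ^ 4 - c * r / ε ≤
      (r / ε - α * r ^ 2) * (2 * s * r ^ 2 + k * r ^ 4 - c) + (1 / (2 * ε * r) - α) * V := by
  have hΦ : 0 ≤ r / ε - α * r ^ 2 := by
    rw [sub_nonneg, le_div_iff₀ hε]
    nlinarith
  have hΦ' : 0 ≤ 1 / (2 * ε * r) - α := by
    rw [sub_nonneg, le_div_iff₀ (by positivity)]
    linarith
  have e1 := mul_le_mul_of_nonneg_left hV hΦ'
  have e2 := mul_le_mul_of_nonneg_left hk (mul_nonneg hΦ (pow_nonneg hr.le 4))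
  have e3 : (r / ε - α * r ^ 2) * (2 * s * r ^ 2 + 4 * s * ε ^ 2 * r ^ 4) -
      (1 / (2 * ε * r) - α) * (4 * s * r ^ 4) =
      2 * s * r ^ 4 * (2 * (ε * r) + α - 2 * α * (ε * r) ^ 2) := by
    field_simp
    ring
  have e4 : 0 ≤ 2 * s * r ^ 4 * (2 * (ε * r) - 2 * α * (ε * r) ^ 2) := by
    have : 0 ≤ 2 * (ε * r) - 2 * α * (ε * r) ^ 2 := by nlinarith [mul_pos hε hr]
    positivity
  have e5 : 0 ≤ c * (α * r ^ 2) := by positivity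
  have e6 : c * r / ε = c * (r / ε) := by ring
  rw [e6]
  nlinarith

lemma integral_pairSum_sq_le (hN : 1 ≤ N) {s : ℝ} (hs : 1 / 2 ≤ s) (hs1 : s < 1)
    (μ : Measure (SOodd N)) [μ.IsHaarMeasure] [IsProbabilityMeasure μ] :
    (1 - s) * ∫ X, pairSum N s (mat X) ^ 2 ∂μ ≤ 4 * N ^ 4 := by
  have hs0 : 0 < s := by linarith
  have hε : 0 < 1 - s := sub_pos.2 hs1
  have hN1 : (1 : ℝ) ≤ N := by exact_mod_cast hN
  have hcR := continuous_pairSum (N := N) hs0 hs1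
  have hcV := continuous_pairVariation (N := N) hs0 hs1
  have hpos := pairSum_pos hN hs0 hs1
  set α : ℝ := 1 / (4 * N) with hα
  have h := integral_loop_eq_zero hN hs0 hs1 μ (Φ := fun R => √R / (1 - s) - α * R)
    (Φ' := fun R => 1 / (2 * (1 - s) * √R) - α)
    (fun r hr => by
      refine (((hasDerivAt_sqrt hr.ne').div_const (1 - s)).fun_sub
        ((hasDerivAt_id' r).const_mul α)).congr_deriv ?_
      rw [div_div, mul_one]
      ring_nf)
    (by
      refine ContinuousOn.sub (continuousOn_const.div (by fun_prop) fun r hr => ?_)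
        continuousOn_const
      have := sqrt_pos.2 (Set.mem_Ioi.1 hr)
      positivity)
  have hcinv : Continuous fun X : SOodd N => 1 / (2 * (1 - s) * √(pairSum N s (mat X))) :=
    continuous_const.div (by fun_prop) fun X => by
      have := sqrt_pos.2 (hpos X)
      positivity
  have hmono : ∫ X, (2 * s * α * pairSum N s (mat X) ^ 2 -
      N ^ 2 * ((pairSum N s (mat X) / N + N) / 2) / (1 - s)) ∂μ ≤ 0 := by
    rw [← h]
    refine integral_mono (integrable_of_continuous μ (by fun_prop))
      (integrable_of_continuous μ (by fun_prop)) fun X => ?_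
    have hR := hpos X
    set R := pairSum N s (mat X) with hRdef
    set r := √R with hr
    have hr0 : 0 < r := sqrt_pos.2 hR
    have hr2 : R = r ^ 2 := (sq_sqrt hR.le).symm
    have hεr : (1 - s) * r ≤ N := by
      have hub := (pairSum_bounds hs0 hs1 X).2
      rw [← hRdef, hr2, le_div_iff₀ (by positivity)] at hub
      nlinarith [mul_pos hε hr0]
    have hV : -(4 * s * r ^ 4) ≤ pairVariation N s (mat X) := by
      have := pairVariation_ge hs0 hs1 X
      rw [← hRdef, hr2] at this
      linarith
    have hb := loop_integrand_ge (α := α) (c := (N : ℝ) ^ 2) (k := (1 - s ^ 2) ^ 2) hr0 hε hs0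
      (by positivity) (by positivity) (by
        rw [hα]
        field_simp
        linarith) (by nlinarith [sq_nonneg ((1 - s) ^ 2)]) hV
    have hamgm : r ≤ (R / N + N) / 2 := by
      have : r * (2 * N) ≤ r ^ 2 + N ^ 2 := by nlinarith [sq_nonneg (r - N)]
      rw [hr2]
      field_simp
      nlinarith
    have hstep : (N : ℝ) ^ 2 * r / (1 - s) ≤ N ^ 2 * ((R / N + N) / 2) / (1 - s) := by gcongr
    have e : R ^ 2 = r ^ 4 := by rw [hr2]; ring
    have e' : (r / (1 - s) - α * R) * (2 * s * R + (1 - s ^ 2) ^ 2 * R ^ 2 - N ^ 2) +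
        (1 / (2 * (1 - s) * r) - α) * pairVariation N s (mat X) =
        (r / (1 - s) - α * r ^ 2) * (2 * s * r ^ 2 + (1 - s ^ 2) ^ 2 * r ^ 4 - N ^ 2) +
        (1 / (2 * (1 - s) * r) - α) * pairVariation N s (mat X) := by rw [e, hr2]
    show _ ≤ (r / (1 - s) - α * R) * (2 * s * R + (1 - s ^ 2) ^ 2 * R ^ 2 - N ^ 2) +
        (1 / (2 * (1 - s) * r) - α) * pairVariation N s (mat X)
    rw [e', e]
    linarith
  have hlin := integral_pairSum_add hN hs0 hs1 μ
  set E1 := ∫ X, pairSum N s (mat X) ∂μ with hE1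
  set E2 := ∫ X, pairSum N s (mat X) ^ 2 ∂μ with hE2
  have hE2nn : 0 ≤ E2 := integral_nonneg fun X => sq_nonneg _
  have hE1nn : 0 ≤ E1 := integral_nonneg fun X => (hpos X).le
  have hE1le : E1 ≤ N ^ 2 := by nlinarith [mul_nonneg (sq_nonneg (1 - s ^ 2)) hE2nn]
  have hsplit : ∫ X, (2 * s * α * pairSum N s (mat X) ^ 2 -
      N ^ 2 * ((pairSum N s (mat X) / N + N) / 2) / (1 - s)) ∂μ =
      2 * s * α * E2 - N ^ 2 * ((E1 / N + N) / 2) / (1 - s) := by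
    rw [integral_sub (integrable_of_continuous μ (by fun_prop))
      (integrable_of_continuous μ (by fun_prop)), integral_const_mul, integral_div,
      integral_const_mul, integral_div, integral_add (integrable_of_continuous μ (by fun_prop))
      (integrable_const _), integral_div]
    simp [hE1, hE2]
  rw [hsplit, hα] at hmono
  have h3 : (N : ℝ) ^ 2 * ((E1 / N + N) / 2) / (1 - s) ≤ N ^ 3 / (1 - s) := by
    have : E1 / N ≤ N := by rw [div_le_iff₀ (by linarith)]; linarith
    gcongr
    nlinarith [sq_nonneg (N : ℝ)]
  have h4 : 2 * s * (1 / (4 * N)) * E2 ≤ N ^ 3 / (1 - s) := by linarith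
  rw [le_div_iff₀ hε] at h4
  have h5 : 2 * s * E2 * (1 - s) ≤ 4 * N ^ 4 := by
    have : 2 * s * E2 * (1 - s) = 4 * N * (2 * s * (1 / (4 * N)) * E2 * (1 - s)) := by
      field_simp
    rw [this]
    nlinarith
  nlinarith [mul_nonneg hE2nn hε.le]

end Moments

section Estimates

lemma inv_bounds_of_half_le {s : ℝ} (hs : 1 / 2 ≤ s) : 1 / s ≤ 2 ∧ 1 / s ^ 2 ≤ 4 := by
  have hs0 : 0 < s := by linarith
  constructor
  · rw [div_le_iff₀ hs0]
    linarith
  · rw [div_le_iff₀ (by positivity)]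
    nlinarith

lemma first_moment_estimate {s n E₁ E₂ : ℝ} (hs : 1 / 2 ≤ s) (hs1 : s < 1) (hn : 1 ≤ n)
    (hE₂ : 0 ≤ E₂) (hlin : 2 * s * E₁ + (1 - s ^ 2) ^ 2 * E₂ = n ^ 2)
    (hsq : (1 - s) * E₂ ≤ 4 * n ^ 4) :
    |(1 - s) / s * ((1 - s ^ 2) * E₁ - n) -
      (-(n * (1 - s)) - n * (1 - s) ^ 2 + n ^ 2 * (1 - s) ^ 2)| ≤ 72 * (n ^ 4 * (1 - s) ^ 3) := by
  obtain ⟨hi1, hi2⟩ := inv_bounds_of_half_le hs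
  have hs0 : 0 < s := by linarith
  obtain ⟨ε, rfl⟩ : ∃ ε, s = 1 - ε := ⟨1 - s, by ring⟩
  have hε : 0 < ε := by linarith
  have hE₁ : E₁ = (n ^ 2 - (1 - (1 - ε) ^ 2) ^ 2 * E₂) / (2 * (1 - ε)) := by
    rw [eq_div_iff (by positivity)]
    linarith
  simp only [sub_sub_cancel] at *
  have hid : ε / (1 - ε) * ((1 - (1 - ε) ^ 2) * E₁ - n) -
      (-(n * ε) - n * ε ^ 2 + n ^ 2 * ε ^ 2) =
      n ^ 2 * ε ^ 3 * ((3 - 2 * ε) / 2) * (1 / (1 - ε) ^ 2) - n * ε ^ 3 * (1 / (1 - ε)) -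
        ε ^ 3 * (ε * E₂) * ((2 - ε) ^ 3 / 2) * (1 / (1 - ε) ^ 2) := by
    rw [hE₁]
    field_simp
    ring
  have hn2 : n ^ 2 ≤ n ^ 4 := pow_le_pow_right₀ hn (by norm_num)
  have hn1 : n ≤ n ^ 4 := by simpa using pow_le_pow_right₀ hn (show 1 ≤ 4 by norm_num)
  have hp1 : 0 ≤ 1 / (1 - ε) := by positivity
  have hp2 : 0 ≤ 1 / (1 - ε) ^ 2 := by positivity
  have h2ε : 0 ≤ 2 - ε := by linarith
  have h3ε : 0 ≤ (3 - 2 * ε) / 2 := by linarith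
  have ha0 : 0 ≤ n ^ 2 * ε ^ 3 * ((3 - 2 * ε) / 2) * (1 / (1 - ε) ^ 2) := by positivity
  have hb0 : 0 ≤ n * ε ^ 3 * (1 / (1 - ε)) := by positivity
  have hc0 : 0 ≤ ε ^ 3 * (ε * E₂) * ((2 - ε) ^ 3 / 2) * (1 / (1 - ε) ^ 2) := by positivity
  have ha : n ^ 2 * ε ^ 3 * ((3 - 2 * ε) / 2) * (1 / (1 - ε) ^ 2) ≤
      n ^ 4 * ε ^ 3 * (3 / 2) * 4 := by
    gcongr
    linarith
  have hb : n * ε ^ 3 * (1 / (1 - ε)) ≤ n ^ 4 * ε ^ 3 * 2 := by gcongr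
  have hc : ε ^ 3 * (ε * E₂) * ((2 - ε) ^ 3 / 2) * (1 / (1 - ε) ^ 2) ≤
      ε ^ 3 * (4 * n ^ 4) * (2 ^ 3 / 2) * 4 := by
    gcongr
    linarith
  rw [hid, abs_le]
  constructor <;> linarith

lemma second_moment_estimate {s n E₁ E₂ : ℝ} (hs : 1 / 2 ≤ s) (hs1 : s < 1) (hn : 1 ≤ n)
    (hE₁ : 0 ≤ E₁) (hE₂ : 0 ≤ E₂) (hlin : 2 * s * E₁ + (1 - s ^ 2) ^ 2 * E₂ = n ^ 2)
    (hsq : (1 - s) * E₂ ≤ 4 * n ^ 4) :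
    |((1 - s) / s) ^ 2 * ((1 - s ^ 2) ^ 2 * E₂ - 2 * (1 - s ^ 2) * n * E₁ + n ^ 2) -
      n ^ 2 * (1 - s) ^ 2| ≤ 72 * (n ^ 4 * (1 - s) ^ 3) := by
  obtain ⟨-, hi2⟩ := inv_bounds_of_half_le hs
  have hs0 : 0 < s := by linarith
  have hE₁n : E₁ ≤ n ^ 2 := by nlinarith [mul_nonneg (sq_nonneg (1 - s ^ 2)) hE₂]
  obtain ⟨ε, rfl⟩ : ∃ ε, s = 1 - ε := ⟨1 - s, by ring⟩
  have hε : 0 < ε := by linarith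
  simp only [sub_sub_cancel] at *
  have hid : (ε / (1 - ε)) ^ 2 *
      ((1 - (1 - ε) ^ 2) ^ 2 * E₂ - 2 * (1 - (1 - ε) ^ 2) * n * E₁ + n ^ 2) - n ^ 2 * ε ^ 2 =
      ε ^ 3 * (ε * E₂) * (2 - ε) ^ 2 * (1 / (1 - ε) ^ 2) -
        ε ^ 3 * (2 * (2 - ε)) * (n * E₁) * (1 / (1 - ε) ^ 2) +
          n ^ 2 * ε ^ 3 * (2 - ε) * (1 / (1 - ε) ^ 2) := by
    field_simp
    ring
  have hn2 : n ^ 2 ≤ n ^ 4 := pow_le_pow_right₀ hn (by norm_num)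
  have hn3 : n * E₁ ≤ n ^ 4 := by
    have : n * E₁ ≤ n * n ^ 2 := by gcongr
    have : n ^ 3 ≤ n ^ 4 := pow_le_pow_right₀ hn (by norm_num)
    linarith
  have hp2 : 0 ≤ 1 / (1 - ε) ^ 2 := by positivity
  have h2ε : 0 ≤ 2 - ε := by linarith
  have ha0 : 0 ≤ ε ^ 3 * (ε * E₂) * (2 - ε) ^ 2 * (1 / (1 - ε) ^ 2) := by positivity
  have hb0 : 0 ≤ ε ^ 3 * (2 * (2 - ε)) * (n * E₁) * (1 / (1 - ε) ^ 2) := by positivity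
  have hc0 : 0 ≤ n ^ 2 * ε ^ 3 * (2 - ε) * (1 / (1 - ε) ^ 2) := by positivity
  have ha : ε ^ 3 * (ε * E₂) * (2 - ε) ^ 2 * (1 / (1 - ε) ^ 2) ≤
      ε ^ 3 * (4 * n ^ 4) * 2 ^ 2 * 4 := by
    gcongr
    linarith
  have hb : ε ^ 3 * (2 * (2 - ε)) * (n * E₁) * (1 / (1 - ε) ^ 2) ≤
      ε ^ 3 * (2 * 2) * n ^ 4 * 4 := by
    gcongr
    linarith
  have hc : n ^ 2 * ε ^ 3 * (2 - ε) * (1 / (1 - ε) ^ 2) ≤ n ^ 4 * ε ^ 3 * 2 * 4 := by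
    gcongr
    linarith
  rw [hid, abs_le]
  constructor <;> linarith

lemma third_moment_pointwise {s n R : ℝ} (hs : 1 / 2 ≤ s) (hs1 : s < 1) (hn : 1 ≤ n)
    (hR : 0 ≤ R) (hRn : R ≤ n / (1 - s) ^ 2) :
    |(1 - s) / s * ((1 - s ^ 2) * R - n)| ^ 3 ≤
      32 * (1 - s) ^ 3 * (8 * n * ((1 - s) * R ^ 2) + n ^ 3) := by
  obtain ⟨hi1, -⟩ := inv_bounds_of_half_le hs
  have hs0 : 0 < s := by linarith
  obtain ⟨ε, rfl⟩ : ∃ ε, s = 1 - ε := ⟨1 - s, by ring⟩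
  simp only [sub_sub_cancel] at *
  have hε : 0 < ε := by linarith
  rw [le_div_iff₀ (by positivity)] at hRn
  have h1 : |ε / (1 - ε) * ((1 - (1 - ε) ^ 2) * R - n)| ≤ ε * 2 * (2 * ε * R + n) := by
    rw [abs_mul, abs_of_nonneg (by positivity), div_eq_mul_one_div]
    have : |(1 - (1 - ε) ^ 2) * R - n| ≤ 2 * ε * R + n := by
      rw [abs_le]
      constructor <;> nlinarith [mul_nonneg hε.le hR, mul_nonneg (mul_nonneg hε.le hε.le) hR]
    gcongr
  have h2 : (2 * ε * R + n) ^ 3 ≤ 4 * ((2 * ε * R) ^ 3 + n ^ 3) := by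
    have hx : 0 ≤ 2 * ε * R := by positivity
    nlinarith [mul_nonneg (add_nonneg hx (by linarith : (0 : ℝ) ≤ n)) (sq_nonneg (2 * ε * R - n))]
  have h3 : (2 * ε * R) ^ 3 ≤ 8 * n * (ε * R ^ 2) := by
    have : (2 * ε * R) ^ 3 = 8 * (R * ε ^ 2) * (ε * R ^ 2) := by ring
    rw [this]
    gcongr
  calc |ε / (1 - ε) * ((1 - (1 - ε) ^ 2) * R - n)| ^ 3 ≤ (ε * 2 * (2 * ε * R + n)) ^ 3 := by
        gcongr
    _ = 8 * ε ^ 3 * (2 * ε * R + n) ^ 3 := by ring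
    _ ≤ 8 * ε ^ 3 * (4 * (8 * n * (ε * R ^ 2) + n ^ 3)) := by
        gcongr
        linarith
    _ = _ := by ring

lemma deviation_mem_Icc {s n R : ℝ} (hs : 0 < s) (hs1 : s < 1) (hn : 0 ≤ n)
    (hsn : 2 * (1 - s) * n / (s + 1) ≤ 1 / 2) (hR : n / (1 + s) ^ 2 ≤ R)
    (hRn : R ≤ n / (1 - s) ^ 2) :
    (1 - s) / s * ((1 - s ^ 2) * R - n) ∈ Set.Icc (-1 / 2) (4 * n) := by
  have hε : 0 < 1 - s := sub_pos.2 hs1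
  have hk : 0 ≤ 1 - s ^ 2 := by nlinarith
  constructor
  · have h : (1 - s) / s * ((1 - s ^ 2) * (n / (1 + s) ^ 2) - n) =
        -(2 * (1 - s) * n / (s + 1)) := by
      field_simp
      ring
    have : (1 - s) / s * ((1 - s ^ 2) * (n / (1 + s) ^ 2) - n) ≤
        (1 - s) / s * ((1 - s ^ 2) * R - n) := by gcongr
    linarith
  · have h : (1 - s) / s * ((1 - s ^ 2) * (n / (1 - s) ^ 2) - n) = 2 * n := by
      field_simp
      ring
    have : (1 - s) / s * ((1 - s ^ 2) * R - n) ≤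
        (1 - s) / s * ((1 - s ^ 2) * (n / (1 - s) ^ 2) - n) := by gcongr
    linarith

end Estimates

/-- Uniform expansion of the `K`-th moment of the (negated) logarithmic derivative of
characteristic polynomials over `SO(2N+1)`, valid whenever `2(1-s)N/(s+1) ≤ 1/2`. -/
theorem moment_expansion_uniform
    (K : ℝ) (hK : 0 < K)
    (m : ℤ) (hmodd : Odd m) (hm3 : 3 ≤ m) (hmK : ⌊K⌋ ≤ m)
    (μ : (N : ℕ) → Measure (SOodd N))
    (hμHaar : ∀ N : ℕ, (μ N).IsHaarMeasure)
    (hμProb : ∀ N : ℕ, IsProbabilityMeasure (μ N)) :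
    ∃ M : ℝ, 0 < M ∧ ∀ N : ℕ, 1 ≤ N → ∀ s : ℝ, 0 < s → s < 1 →
      2 * (1 - s) * N / (s + 1) ≤ 1 / 2 →
      (∀ X : SOodd N, 0 < -(logDeriv (charPoly X) s)) ∧
      |(1 - s) ^ K * (∫ X, (-(logDeriv (charPoly X) s)) ^ K ∂(μ N)) -
          (1 - K * N * (1 - s) - K * N * (1 - s) ^ 2 +
            K * (K + 1) / 2 * (N : ℝ) ^ 2 * (1 - s) ^ 2)| ≤
        M * ((N : ℝ) ^ (m + 5) * (1 - s) ^ 4 + (N : ℝ) ^ (m + 3) * (1 - s) ^ 3) := by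
  have h5K : (0 : ℝ) < 5 ^ K := by positivity
  refine ⟨|K| * 72 + |K * (K - 1) / 2| * 72 +
    |K * (K - 1) * (K - 2)| * (8 + 5 ^ K) * 1056 + 1, by positivity, ?_⟩
  intro N hN s hs0 hs1 hsN
  have := hμHaar N
  have := hμProb N
  have hε : 0 < 1 - s := sub_pos.2 hs1
  have hN1 : (1 : ℝ) ≤ N := by exact_mod_cast hN
  have hs : 1 / 2 ≤ s := by
    rw [div_le_iff₀ (by linarith)] at hsN
    nlinarith
  set u : SOodd N → ℝ := fun X => (1 - s) / s * ((1 - s ^ 2) * pairSum N s (mat X) - N) with hu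
  have hcR := continuous_pairSum (N := N) hs0 hs1
  have hcu : Continuous u := by fun_prop
  have hmem : ∀ X, u X ∈ Set.Icc (-1 / 2 : ℝ) (4 * N) := fun X =>
    deviation_mem_Icc hs0 hs1 (by linarith) hsN (pairSum_bounds hs0 hs1 X).1
      (pairSum_bounds hs0 hs1 X).2
  have hpos : ∀ X, 0 < 1 + u X := fun X => by linarith [(hmem X).1]
  have hlog : ∀ X, -(logDeriv (charPoly X) s) = (1 + u X) / (1 - s) := by
    intro X
    obtain ⟨x, -, -, -, h, -⟩ := exists_pairSum_eq hs0 hs1 X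
    rw [h, hu]
    field_simp
  refine ⟨fun X => by rw [hlog]; exact div_pos (hpos X) hε, ?_⟩
  have hcpow : Continuous fun X => (1 + u X) ^ K :=
    (continuous_const.add hcu).rpow_const fun X => Or.inl (hpos X).ne'
  have hmoment : (1 - s) ^ K * ∫ X, (-(logDeriv (charPoly X) s)) ^ K ∂(μ N) =
      ∫ X, (1 + u X) ^ K ∂(μ N) := by
    rw [← integral_const_mul]
    refine integral_congr_ae (Eventually.of_forall fun X => ?_)
    simp only [hlog]
    rw [← mul_rpow hε.le (div_pos (hpos X) hε).le, mul_div_cancel₀ _ hε.ne']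
  have hlin := integral_pairSum_add hN hs0 hs1 (μ N)
  have hsq := integral_pairSum_sq_le hN hs hs1 (μ N)
  have hE1 : 0 ≤ ∫ X, pairSum N s (mat X) ∂(μ N) :=
    integral_nonneg fun X => (pairSum_pos hN hs0 hs1 X).le
  have hE2 : 0 ≤ ∫ X, pairSum N s (mat X) ^ 2 ∂(μ N) := integral_nonneg fun X => sq_nonneg _
  have hm1 := first_moment_estimate hs hs1 hN1 hE2 hlin hsq
  have hm2 := second_moment_estimate hs hs1 hN1 hE1 hE2 hlin hsq
  have hu1 : ∫ X, u X ∂(μ N) =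
      (1 - s) / s * ((1 - s ^ 2) * ∫ X, pairSum N s (mat X) ∂(μ N) - N) := by
    rw [hu, integral_const_mul, integral_sub (integrable_of_continuous _ (by fun_prop))
      (integrable_const _), integral_const_mul]
    simp
  have hu2 : ∫ X, u X ^ 2 ∂(μ N) = ((1 - s) / s) ^ 2 *
      ((1 - s ^ 2) ^ 2 * ∫ X, pairSum N s (mat X) ^ 2 ∂(μ N) -
        2 * (1 - s ^ 2) * N * ∫ X, pairSum N s (mat X) ∂(μ N) + N ^ 2) := by
    have : ∀ X, u X ^ 2 = ((1 - s) / s) ^ 2 * ((1 - s ^ 2) ^ 2 * pairSum N s (mat X) ^ 2 -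
        2 * (1 - s ^ 2) * N * pairSum N s (mat X) + N ^ 2) := fun X => by
      simp only [hu]
      ring
    simp only [this]
    rw [integral_const_mul, integral_add (integrable_of_continuous _ (by fun_prop))
      (integrable_const _), integral_sub (integrable_of_continuous _ (by fun_prop))
      (integrable_of_continuous _ (by fun_prop)), integral_const_mul, integral_const_mul]
    simp
  rw [← hu1] at hm1
  rw [← hu2] at hm2
  have hu3 : ∫ X, |u X| ^ 3 ∂(μ N) ≤ 1056 * ((N : ℝ) ^ 5 * (1 - s) ^ 3) := by
    have hle : ∫ X, |u X| ^ 3 ∂(μ N) ≤ ∫ X, 32 * (1 - s) ^ 3 *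
        (8 * N * ((1 - s) * pairSum N s (mat X) ^ 2) + N ^ 3) ∂(μ N) :=
      integral_mono (integrable_of_continuous _ (by fun_prop))
        (integrable_of_continuous _ (by fun_prop)) fun X =>
          third_moment_pointwise hs hs1 hN1 (pairSum_pos hN hs0 hs1 X).le
            (pairSum_bounds hs0 hs1 X).2
    rw [integral_const_mul, integral_add (integrable_of_continuous _ (by fun_prop))
      (integrable_const _), integral_const_mul, integral_const_mul, integral_const,
      probReal_univ, one_smul] at hle
    have hN35 : (N : ℝ) ^ 3 ≤ (N : ℝ) ^ 5 := pow_le_pow_right₀ hN1 (by norm_num)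
    calc _ ≤ _ := hle
      _ ≤ 32 * (1 - s) ^ 3 * (8 * N * (4 * (N : ℝ) ^ 4) + (N : ℝ) ^ 5) := by gcongr
      _ = 1056 * ((N : ℝ) ^ 5 * (1 - s) ^ 3) := by ring
  clear_value u
  set D : ℝ := |K * (K - 1) * (K - 2)| * ((8 + 5 ^ K) * (N : ℝ) ^ (m - 2)) with hD
  have hD0 : 0 ≤ D := by positivity
  have htaylor : |∫ X, (1 + u X) ^ K ∂(μ N) - 1 - K * ∫ X, u X ∂(μ N) -
      K * (K - 1) / 2 * ∫ X, u X ^ 2 ∂(μ N)| ≤ D * ∫ X, |u X| ^ 3 ∂(μ N) := by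
    have hsplit : ∫ X, (1 + u X) ^ K ∂(μ N) - 1 - K * ∫ X, u X ∂(μ N) -
        K * (K - 1) / 2 * ∫ X, u X ^ 2 ∂(μ N) =
        ∫ X, ((1 + u X) ^ K - 1 - K * u X - K * (K - 1) / 2 * u X ^ 2) ∂(μ N) := by
      rw [integral_sub (integrable_of_continuous _ (by fun_prop))
        (integrable_of_continuous _ (by fun_prop)),
        integral_sub (integrable_of_continuous _ (by fun_prop))
        (integrable_of_continuous _ (by fun_prop)),
        integral_sub (integrable_of_continuous _ hcpow) (integrable_const _),
        integral_const_mul, integral_const_mul]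
      simp
    rw [hsplit, ← integral_const_mul]
    refine (abs_integral_le_integral_abs).trans (integral_mono
      (integrable_of_continuous _ (by fun_prop)) (integrable_of_continuous _ (by fun_prop))
      fun X => ?_)
    exact abs_rpow_one_add_sub_le (by norm_num) (by positivity) (by norm_num)
      (fun v hv => mul_le_mul_of_nonneg_left (rpow_sub_three_le hm3 hmK hK hN hv)
        (abs_nonneg _)) (hmem X)
  have hN4 : (N : ℝ) ^ 4 ≤ (N : ℝ) ^ (m + 3) := by
    rw [← zpow_natCast]
    exact zpow_le_zpow_right₀ hN1 (by push_cast; omega)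
  have hN5 : (N : ℝ) ^ (m - 2) * (N : ℝ) ^ 5 = (N : ℝ) ^ (m + 3) := by
    rw [← zpow_natCast, ← zpow_add₀ (by positivity)]
    congr 1
    push_cast
    ring
  set Z : ℝ := (N : ℝ) ^ (m + 3) * (1 - s) ^ 3 with hZ
  have hZ0 : 0 ≤ Z := by positivity
  have hNZ : (N : ℝ) ^ 4 * (1 - s) ^ 3 ≤ Z :=
    mul_le_mul_of_nonneg_right hN4 (by positivity)
  have hW0 : 0 ≤ (N : ℝ) ^ (m + 5) * (1 - s) ^ 4 := by positivity
  have hb3 : D * ∫ X, |u X| ^ 3 ∂(μ N) ≤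
      |K * (K - 1) * (K - 2)| * (8 + 5 ^ K) * 1056 * Z := by
    refine (mul_le_mul_of_nonneg_left hu3 hD0).trans_eq ?_
    rw [hD, hZ, ← hN5]
    ring
  rw [hmoment]
  set I0 := ∫ X, (1 + u X) ^ K ∂(μ N)
  set I1 := ∫ X, u X ∂(μ N)
  set I2 := ∫ X, u X ^ 2 ∂(μ N)
  have hdecomp : I0 - (1 - K * N * (1 - s) - K * N * (1 - s) ^ 2 +
      K * (K + 1) / 2 * (N : ℝ) ^ 2 * (1 - s) ^ 2) =
      (I0 - 1 - K * I1 - K * (K - 1) / 2 * I2) +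
      K * (I1 - (-(N * (1 - s)) - N * (1 - s) ^ 2 + N ^ 2 * (1 - s) ^ 2)) +
      K * (K - 1) / 2 * (I2 - N ^ 2 * (1 - s) ^ 2) := by ring
  have hb1 : |K * (I1 - (-(N * (1 - s)) - N * (1 - s) ^ 2 + N ^ 2 * (1 - s) ^ 2))| ≤
      |K| * 72 * Z := by
    rw [abs_mul, mul_assoc]
    gcongr
    linarith
  have hb2 : |K * (K - 1) / 2 * (I2 - N ^ 2 * (1 - s) ^ 2)| ≤
      |K * (K - 1) / 2| * 72 * Z := by
    rw [abs_mul, mul_assoc]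
    gcongr
    linarith
  rw [hdecomp]
  set M : ℝ := |K| * 72 + |K * (K - 1) / 2| * 72 +
    |K * (K - 1) * (K - 2)| * (8 + 5 ^ K) * 1056 + 1 with hM
  have hM0 : 0 ≤ M := by positivity
  calc _ ≤ _ := (abs_add_le _ _).trans (add_le_add_left (abs_add_le _ _) _)
    _ ≤ |K * (K - 1) * (K - 2)| * (8 + 5 ^ K) * 1056 * Z + |K| * 72 * Z +
        |K * (K - 1) / 2| * 72 * Z := add_le_add (add_le_add (htaylor.trans hb3) hb1) hb2
    _ ≤ M * Z := by
      rw [hM]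
      linarith
    _ ≤ M * ((N : ℝ) ^ (m + 5) * (1 - s) ^ 4 + Z) := by
      gcongr
      linarith
end
end

section
/- There exists a constant C > 0 such that for every N ∈ ℕ and all θ_1, θ_2 ∈ [0, π], ( S_{2N}(θ_1 − θ_2) − S_{2N}(θ_1 + θ_2) )² ≤ C · N⁴ ( sin²(θ_1/2) + sin²(θ_2/2) ). -/
open Real

noncomputable section

/-- `S_{2N}(x) = sin(Nx)/(2π sin(x/2))`, written via its everywhere-continuous expression
`(1/2π) Σ_{k=0}^{2N-1} cos(x(2k+1-2N)/2)` (its extension by continuity, with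
`S_{2N}(0) = N/π`). -/
def S2N (N : ℕ) (x : ℝ) : ℝ :=
  (1 / (2 * π)) * ∑ k ∈ Finset.range (2 * N), Real.cos (x * (2 * (k : ℝ) + 1 - 2 * N) / 2)

/-- Jordan's inequality at the half angle. -/
lemma le_pi_mul_sin_half {θ : ℝ} (hθ : θ ∈ Set.Icc (0 : ℝ) π) : θ ≤ π * Real.sin (θ / 2) := by
  have h := Real.mul_le_sin (x := θ / 2) (by linarith [hθ.1]) (by linarith [hθ.2])
  calc θ = π * (2 / π * (θ / 2)) := by field_simp
    _ ≤ π * Real.sin (θ / 2) := by gcongr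

lemma abs_cos_mul_sub_sub_cos_mul_add_le {θ₁ θ₂ m M : ℝ} (hθ : θ₁ ∈ Set.Icc (0 : ℝ) π)
    (hm : |m| ≤ M) :
    |Real.cos ((θ₁ - θ₂) * m) - Real.cos ((θ₁ + θ₂) * m)| ≤
      2 * M * (π * Real.sin (θ₁ / 2)) := by
  have hprod : Real.cos ((θ₁ - θ₂) * m) - Real.cos ((θ₁ + θ₂) * m) =
      2 * Real.sin (m * θ₁) * Real.sin (m * θ₂) := by
    rw [show (θ₁ - θ₂) * m = m * θ₁ - m * θ₂ by ring,
      show (θ₁ + θ₂) * m = m * θ₁ + m * θ₂ by ring, Real.cos_sub, Real.cos_add]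
    ring
  have hsin : |Real.sin (m * θ₁)| ≤ M * (π * Real.sin (θ₁ / 2)) :=
    calc |Real.sin (m * θ₁)| ≤ |m * θ₁| := Real.abs_sin_le_abs
      _ = |m| * θ₁ := by rw [abs_mul, abs_of_nonneg hθ.1]
      _ ≤ M * (π * Real.sin (θ₁ / 2)) :=
        mul_le_mul hm (le_pi_mul_sin_half hθ) hθ.1 ((abs_nonneg m).trans hm)
  rw [hprod, abs_mul, abs_mul, abs_two]
  calc 2 * |Real.sin (m * θ₁)| * |Real.sin (m * θ₂)| ≤ 2 * |Real.sin (m * θ₁)| * 1 := by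
        gcongr
        exact Real.abs_sin_le_one _
    _ ≤ 2 * M * (π * Real.sin (θ₁ / 2)) := by linarith

lemma abs_S2N_sub_sub_S2N_add_le (N : ℕ) {θ₁ : ℝ} (θ₂ : ℝ) (hθ : θ₁ ∈ Set.Icc (0 : ℝ) π) :
    |S2N N (θ₁ - θ₂) - S2N N (θ₁ + θ₂)| ≤ 2 * (N : ℝ) ^ 2 * Real.sin (θ₁ / 2) := by
  rw [S2N, S2N, ← mul_sub, ← Finset.sum_sub_distrib, abs_mul, abs_of_pos (by positivity)]
  have hterm : ∀ k ∈ Finset.range (2 * N),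
      |Real.cos ((θ₁ - θ₂) * (2 * (k : ℝ) + 1 - 2 * N) / 2) -
        Real.cos ((θ₁ + θ₂) * (2 * (k : ℝ) + 1 - 2 * N) / 2)| ≤
        2 * N * (π * Real.sin (θ₁ / 2)) := by
    intro k hk
    have hk' : (k : ℝ) + 1 ≤ 2 * N := by exact_mod_cast Finset.mem_range.mp hk
    have hk₀ : (0 : ℝ) ≤ k := k.cast_nonneg
    rw [mul_div_assoc, mul_div_assoc]
    exact abs_cos_mul_sub_sub_cos_mul_add_le hθ (abs_le.mpr ⟨by linarith, by linarith⟩)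
  have hsum := (Finset.abs_sum_le_sum_abs _ _).trans (Finset.sum_le_card_nsmul _ _ _ hterm)
  rw [Finset.card_range, nsmul_eq_mul] at hsum
  refine (mul_le_mul_of_nonneg_left hsum (by positivity)).trans_eq ?_
  push_cast
  field_simp

/-- Bound on the squared off-diagonal kernel of the two-point correlation function. -/
theorem kernel_sq_bound :
    ∃ C : ℝ, 0 < C ∧ ∀ (N : ℕ) (θ₁ θ₂ : ℝ), θ₁ ∈ Set.Icc (0 : ℝ) π → θ₂ ∈ Set.Icc (0 : ℝ) π →
      (S2N N (θ₁ - θ₂) - S2N N (θ₁ + θ₂)) ^ 2 ≤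
        C * (N : ℝ) ^ 4 * (Real.sin (θ₁ / 2) ^ 2 + Real.sin (θ₂ / 2) ^ 2) := by
  refine ⟨4, by norm_num, fun N θ₁ θ₂ h₁ _ => ?_⟩
  calc (S2N N (θ₁ - θ₂) - S2N N (θ₁ + θ₂)) ^ 2
      = |S2N N (θ₁ - θ₂) - S2N N (θ₁ + θ₂)| ^ 2 := (sq_abs _).symm
    _ ≤ (2 * (N : ℝ) ^ 2 * Real.sin (θ₁ / 2)) ^ 2 := by
        gcongr
        exact abs_S2N_sub_sub_S2N_add_le N θ₂ h₁
    _ = 4 * (N : ℝ) ^ 4 * Real.sin (θ₁ / 2) ^ 2 := by ring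
    _ ≤ 4 * (N : ℝ) ^ 4 * (Real.sin (θ₁ / 2) ^ 2 + Real.sin (θ₂ / 2) ^ 2) := by
        gcongr
        exact le_add_of_nonneg_right (sq_nonneg _)
end
end
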